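/- arXiv:1701.02656 — 2 statements merged into one kernel-verified Lean document; each statement's English description precedes it below -/
import Mathlib

section
/- Let Ω ⊂ ℝⁿ be open and let σ ∈ L^∞_loc(Ω, ℝⁿ) be such that its distributional divergence Div σ is a signed Radon measure on Ω. Then for every Borel set A ⊂ Ω with (n−1)-dimensional Hausdorff measure H^{n-1}(A) = 0, one has |Div σ|(A) = 0. -/
open MeasureTheory Set Filter Topology Metric
open scoped RealInnerProductSpace ENNReal

noncomputable section

/-- Euclidean space `ℝⁿ`. -/
abbrev Eu (n : ℕ) : Type := EuclideanSpace ℝ (Fin n)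

/-- `(n-1)`-dimensional Hausdorff measure on `ℝⁿ`. -/
def hm (n : ℕ) : Measure (Eu n) := μH[(n : ℝ) - 1]

/-- Smooth test functions compactly supported in `Ω`. -/
def IsTest {n : ℕ} (Ω : Set (Eu n)) (φ : Eu n → ℝ) : Prop :=
  ContDiff ℝ (⊤ : ℕ∞) φ ∧ HasCompactSupport φ ∧ tsupport φ ⊆ Ω

/-- `σ ∈ L^∞(Ω, ℝⁿ)` with `‖σ‖ ≤ C` a.e. on `Ω`. -/
def Bdd {n : ℕ} (Ω : Set (Eu n)) (σ : Eu n → Eu n) (C : ℝ) : Prop :=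
  AEStronglyMeasurable σ (volume.restrict Ω) ∧ ∀ᵐ x ∂(volume.restrict Ω), ‖σ x‖ ≤ C

/-- `σ ∈ L^∞_loc(Ω, ℝⁿ)`. -/
def LocBdd {n : ℕ} (Ω : Set (Eu n)) (σ : Eu n → Eu n) : Prop :=
  AEStronglyMeasurable σ (volume.restrict Ω) ∧
  ∀ K : Set (Eu n), K ⊆ Ω → IsCompact K → ∃ C : ℝ, ∀ᵐ x ∂(volume.restrict K), ‖σ x‖ ≤ C

/-- scalar `u ∈ L^∞_loc(Ω)`. -/
def LocBddFun {n : ℕ} (Ω : Set (Eu n)) (u : Eu n → ℝ) : Prop :=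
  AEStronglyMeasurable u (volume.restrict Ω) ∧
  ∀ K : Set (Eu n), K ⊆ Ω → IsCompact K → ∃ C : ℝ, ∀ᵐ x ∂(volume.restrict K), |u x| ≤ C

/-- scalar `u ∈ L^∞(Ω)` with bound `C`. -/
def BddFun {n : ℕ} (Ω : Set (Eu n)) (u : Eu n → ℝ) (C : ℝ) : Prop :=
  AEStronglyMeasurable u (volume.restrict Ω) ∧ ∀ᵐ x ∂(volume.restrict Ω), |u x| ≤ C

/-- A measure carried by `Ω` which is finite on compact subsets of `Ω` (Radon on `Ω`). -/
def LocFinOn {n : ℕ} (Ω : Set (Eu n)) (μ : Measure (Eu n)) : Prop :=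
  (∀ K : Set (Eu n), K ⊆ Ω → IsCompact K → μ K < ⊤) ∧ μ Ωᶜ = 0

/-- A finite measure carried by `Ω`. -/
def FinOn {n : ℕ} (Ω : Set (Eu n)) (μ : Measure (Eu n)) : Prop :=
  μ univ < ⊤ ∧ μ Ωᶜ = 0

/-- The (signed) measure `μp - μn` represents `-Div σ` on `Ω`: for every test function `φ`
compactly supported in `Ω` one has `∫_Ω σ·∇φ dx = ∫ φ dμp - ∫ φ dμn`. -/
def RepNegDiv {n : ℕ} (Ω : Set (Eu n)) (σ : Eu n → Eu n) (μp μn : Measure (Eu n)) : Prop :=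
  ∀ φ : Eu n → ℝ, IsTest Ω φ →
    ∫ x in Ω, ⟪σ x, gradient φ x⟫ = (∫ x, φ x ∂μp) - ∫ x, φ x ∂μn

/-- `Div σ ≤ 0` in the sense of distributions on `Ω`. -/
def DivNonpos {n : ℕ} (Ω : Set (Eu n)) (σ : Eu n → Eu n) : Prop :=
  ∀ φ : Eu n → ℝ, IsTest Ω φ → (∀ x, 0 ≤ φ x) → 0 ≤ ∫ x in Ω, ⟪σ x, gradient φ x⟫

/-- The set `A` has Lebesgue density zero at the point `x`. -/
def DensityZeroAt {n : ℕ} (A : Set (Eu n)) (x : Eu n) : Prop :=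
  Tendsto (fun r : ℝ => volume (A ∩ ball x r) / volume (ball x r)) (𝓝[>] 0) (𝓝 0)

/-- The upper (approximate) representative `u⁺`: Lebesgue value at approximate continuity
points, larger jump value at approximate jump points. -/
def upperRep {n : ℕ} (u : Eu n → ℝ) (x : Eu n) : ℝ :=
  sInf {t : ℝ | DensityZeroAt {y | t < u y} x}

/-- The lower (approximate) representative `u⁻`. -/
def lowerRep {n : ℕ} (u : Eu n → ℝ) (x : Eu n) : ℝ :=
  sSup {t : ℝ | DensityZeroAt {y | u y < t} x}

/-- The precise (mean-value) representative `u* = (u⁺ + u⁻)/2`. -/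
def preciseRep {n : ℕ} (u : Eu n → ℝ) (x : Eu n) : ℝ := (upperRep u x + lowerRep u x) / 2

/-- `Du = θ·ν` is the gradient measure of `u` on `Ω` with total variation `ν` and
polar vector `θ` (so `ν = |Du|`). -/
def HasGradMeasure {n : ℕ} (Ω : Set (Eu n)) (u : Eu n → ℝ) (ν : Measure (Eu n))
    (θ : Eu n → Eu n) : Prop :=
  (∀ᵐ x ∂ν, ‖θ x‖ = 1) ∧ ν Ωᶜ = 0 ∧
  ∀ φ : Eu n → ℝ, IsTest Ω φ → ∫ x in Ω, u x • gradient φ x = - ∫ x, φ x • θ x ∂ν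

/-- `u ∈ BV_loc(Ω)`. -/
def MemBVLoc {n : ℕ} (Ω : Set (Eu n)) (u : Eu n → ℝ) : Prop :=
  LocallyIntegrableOn u Ω ∧
  ∃ ν θ, LocFinOn Ω ν ∧ HasGradMeasure Ω u ν θ

/-- `g` is the weak (Sobolev) gradient of `u ∈ W^{1,1}(Ω)`. -/
def HasSobGrad {n : ℕ} (Ω : Set (Eu n)) (u : Eu n → ℝ) (g : Eu n → Eu n) : Prop :=
  IntegrableOn g Ω ∧
  ∀ φ : Eu n → ℝ, IsTest Ω φ → ∫ x in Ω, u x • gradient φ x = - ∫ x in Ω, φ x • g x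

/-- `u ∈ W^{1,1}(Ω)`. -/
def MemW11 {n : ℕ} (Ω : Set (Eu n)) (u : Eu n → ℝ) : Prop :=
  IntegrableOn u Ω ∧ ∃ g, HasSobGrad Ω u g

/-- `u ∈ W^{1,1}_loc(Ω)` with weak gradient `g`. -/
def HasSobGradLoc {n : ℕ} (Ω : Set (Eu n)) (u : Eu n → ℝ) (g : Eu n → Eu n) : Prop :=
  LocallyIntegrableOn g Ω ∧
  ∀ φ : Eu n → ℝ, IsTest Ω φ → ∫ x in Ω, u x • gradient φ x = - ∫ x in Ω, φ x • g x

def MemW11Loc {n : ℕ} (Ω : Set (Eu n)) (u : Eu n → ℝ) : Prop :=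
  LocallyIntegrableOn u Ω ∧ ∃ g, HasSobGradLoc Ω u g

/-- `T` is the interior trace of `u` on `∂Ω`, characterized `H^{n-1}`-a.e. on `∂Ω`
by convergence of interior mean values. -/
def IsIntTrace {n : ℕ} (Ω : Set (Eu n)) (u T : Eu n → ℝ) : Prop :=
  ∀ᵐ x ∂((hm n).restrict (frontier Ω)),
    Tendsto (fun r : ℝ => (∫ y in Ω ∩ ball x r, |u y - T x|) / (volume (ball x r)).toReal)
      (𝓝[>] 0) (𝓝 0)

/-- The domain assumption `H^{n-1}(∂Ω) = P(Ω) < ∞`, in the equivalent form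
`𝟙_Ω ∈ BV(ℝⁿ)` with `|D𝟙_Ω| = H^{n-1}⌞∂Ω`. -/
def DomainAssum {n : ℕ} (Ω : Set (Eu n)) : Prop :=
  hm n (frontier Ω) < ⊤ ∧
  ∃ θ, HasGradMeasure (univ : Set (Eu n)) (Ω.indicator fun _ => (1 : ℝ))
    ((hm n).restrict (frontier Ω)) θ

/-- `g` is the normal trace `σ_n*` of `σ` on `∂Ω`, characterized by the Gauss–Green
formula for `W^{1,1} ∩ L^∞` functions; here `μ = -Div σ ≥ 0`. -/
def IsNormalTrace {n : ℕ} (Ω : Set (Eu n)) (σ : Eu n → Eu n) (μ : Measure (Eu n))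
    (g : Eu n → ℝ) : Prop :=
  ∀ (v : Eu n → ℝ) (gv : Eu n → Eu n) (T : Eu n → ℝ),
    MemW11 Ω v → (∃ C, BddFun Ω v C) → HasSobGrad Ω v gv → IsIntTrace Ω v T →
    ∀ φ : Eu n → ℝ, IsTest (univ : Set (Eu n)) φ →
      (- ∫ x in Ω, v x * ⟪σ x, gradient φ x⟫) + (∫ x, φ x * preciseRep v x ∂μ)
        = (∫ x in Ω, φ x * ⟪σ x, gv x⟫) + ∫ x in frontier Ω, φ x * T x * g x ∂(hm n)

/-- Weakly super-1-harmonic: there is `σ ∈ L^∞` with `|σ| ≤ 1` a.e., `Div σ ≤ 0`,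
and `⟨σ, Du⁺⟩ = |Du|` as measures on `Ω`. -/
def SuperOneHarmonic {n : ℕ} (Ω : Set (Eu n)) (u : Eu n → ℝ) : Prop :=
  MemBVLoc Ω u ∧ LocBddFun Ω u ∧
  ∃ σ : Eu n → Eu n, ∃ μ : Measure (Eu n),
    Bdd Ω σ 1 ∧ DivNonpos Ω σ ∧ RepNegDiv Ω σ μ 0 ∧ LocFinOn Ω μ ∧
    ∃ ν θ, LocFinOn Ω ν ∧ HasGradMeasure Ω u ν θ ∧
      ∀ φ : Eu n → ℝ, IsTest Ω φ →
        (- ∫ x in Ω, u x * ⟪σ x, gradient φ x⟫) + (∫ x, φ x * upperRep u x ∂μ)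
          = ∫ x, φ x ∂ν

/-- A compact `H^d`-null set is covered by finitely many small balls centred on it, with arbitrarily
small sum of the `d`-th powers of the radii. -/
theorem exists_finset_ball_cover_of_hausdorffMeasure_eq_zero {X : Type*} [MetricSpace X]
    [Nonempty X] [MeasurableSpace X] [BorelSpace X] {d : ℝ} (hd : 0 ≤ d) {K : Set X} (hK : IsCompact K)
    (h0 : μH[d] K = 0) {δ : ℝ} (hδ : 0 < δ) {ε : ℝ≥0∞} (hε : ε ≠ 0) :
    ∃ (s : Finset ℕ) (x : ℕ → X) (r : ℕ → ℝ), (∀ i ∈ s, x i ∈ K ∧ 0 < r i ∧ r i < δ) ∧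
      K ⊆ ⋃ i ∈ s, ball (x i) (r i) ∧ ∑ i ∈ s, ENNReal.ofReal (r i) ^ d ≤ ε := by
  have hε2 : ε / 2 ≠ 0 := (ENNReal.half_pos hε).ne'
  obtain ⟨e, he0, hesum⟩ := ENNReal.exists_pos_sum_of_countable hε2 ℕ
  rw [Measure.hausdorffMeasure_apply] at h0
  have hδ2 : 0 < ENNReal.ofReal (δ / 2) := ENNReal.ofReal_pos.2 (half_pos hδ)
  have h1 := ENNReal.iSup_eq_zero.1 (ENNReal.iSup_eq_zero.1 h0 (ENNReal.ofReal (δ / 2))) hδ2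
  have h2 := h1.trans_lt (pos_iff_ne_zero.2 hε2)
  simp only [iInf_lt_iff] at h2
  obtain ⟨t, hcov, hdiam, hsum⟩ := h2
  have hsel : ∀ i, (t i ∩ K).Nonempty → ∃ (x : X) (r : ℝ), x ∈ K ∧ 0 < r ∧ r < δ ∧
      t i ⊆ ball x r ∧ ENNReal.ofReal r ^ d ≤ ediam (t i) ^ d + e i := by
    rintro i ⟨x, hxt, hxK⟩
    have hfin : ediam (t i) ≠ ⊤ := ((hdiam i).trans_lt ENNReal.ofReal_lt_top).ne
    have hlt : (ediam (t i)).toReal < δ := by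
      have := ENNReal.toReal_le_of_le_ofReal (half_pos hδ).le (hdiam i)
      linarith
    have hcont : Continuous fun r : ℝ => ENNReal.ofReal r ^ d :=
      ENNReal.continuous_rpow_const.comp ENNReal.continuous_ofReal
    have hval : ENNReal.ofReal (ediam (t i)).toReal ^ d < ediam (t i) ^ d + e i := by
      rw [ENNReal.ofReal_toReal hfin]
      exact ENNReal.lt_add_right (ENNReal.rpow_ne_top_of_nonneg hd hfin)
        (by simpa using (he0 i).ne')
    have hev1 : ∀ᶠ r in 𝓝[>] (ediam (t i)).toReal,
        ENNReal.ofReal r ^ d < ediam (t i) ^ d + e i :=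
      (hcont.tendsto _).mono_left nhdsWithin_le_nhds |>.eventually_lt_const hval
    have hev2 : ∀ᶠ r in 𝓝[>] (ediam (t i)).toReal, r < δ :=
      (eventually_lt_nhds hlt).filter_mono nhdsWithin_le_nhds
    obtain ⟨r, hr1, hr2, hr3⟩ := (hev1.and (hev2.and self_mem_nhdsWithin)).exists
    refine ⟨x, r, hxK, ENNReal.toReal_nonneg.trans_lt hr3, hr2, fun y hy => ?_, hr1.le⟩
    refine (?_ : dist y x ≤ _).trans_lt hr3
    rw [dist_edist]
    exact ENNReal.toReal_mono hfin (edist_le_ediam_of_mem hy hxt)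
  have hsel' : ∀ i, ∃ (x : X) (r : ℝ), (t i ∩ K).Nonempty → x ∈ K ∧ 0 < r ∧ r < δ ∧
      t i ⊆ ball x r ∧ ENNReal.ofReal r ^ d ≤ ediam (t i) ^ d + e i := by
    intro i
    by_cases h : (t i ∩ K).Nonempty
    · obtain ⟨x, r, hxr⟩ := hsel i h
      exact ⟨x, r, fun _ => hxr⟩
    · exact ⟨Classical.arbitrary X, 0, fun h' => (h h').elim⟩
  choose x r hxr using hsel'
  obtain ⟨s, hs, hfin, hKs⟩ := hK.elim_finite_subcover_image (b := {i | (t i ∩ K).Nonempty})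
    (c := fun i => ball (x i) (r i)) (fun _ _ => isOpen_ball) (by
      intro y hy
      obtain ⟨i, hi⟩ := mem_iUnion.1 (hcov hy)
      have hne : (t i ∩ K).Nonempty := ⟨y, hi, hy⟩
      exact mem_biUnion (show i ∈ {i | (t i ∩ K).Nonempty} from hne) ((hxr i hne).2.2.2.1 hi))
  have hs' : ∀ i ∈ hfin.toFinset, (t i ∩ K).Nonempty := fun i hi => hs (hfin.mem_toFinset.1 hi)
  refine ⟨hfin.toFinset, x, r, fun i hi => ?_, by simpa using hKs, ?_⟩
  · obtain ⟨h₁, h₂, h₃, -⟩ := hxr i (hs' i hi)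
    exact ⟨h₁, h₂, h₃⟩
  · calc ∑ i ∈ hfin.toFinset, ENNReal.ofReal (r i) ^ d
        ≤ ∑ i ∈ hfin.toFinset, ((⨆ _ : (t i).Nonempty, ediam (t i) ^ d) + e i) :=
          Finset.sum_le_sum fun i hi => by
            rw [iSup_pos ((hs' i hi).mono inter_subset_left)]
            exact (hxr i (hs' i hi)).2.2.2.2
      _ ≤ (∑' i, ⨆ _ : (t i).Nonempty, ediam (t i) ^ d) + ∑' i, (e i : ℝ≥0∞) := by
          rw [Finset.sum_add_distrib]
          exact add_le_add (ENNReal.sum_le_tsum _) (ENNReal.sum_le_tsum _)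
      _ ≤ ε / 2 + ε / 2 := add_le_add hsum.le hesum.le
      _ = ε := ENNReal.add_halves ε

/-- Smooth cutoffs between concentric balls of radii `r` and `2 r` whose gradient has `L¹` norm
of order `r ^ (n - 1)`. -/
theorem exists_cutoff_ball (m : ℕ) : ∃ C : ℝ≥0∞, C ≠ ⊤ ∧ ∀ (c : Eu (m + 1)) (r : ℝ), 0 < r →
    ∃ φ : Eu (m + 1) → ℝ, ContDiff ℝ (⊤ : ℕ∞) φ ∧ (∀ x, φ x ∈ Icc (0 : ℝ) 1) ∧
      (∀ x ∈ ball c r, φ x = 1) ∧ tsupport φ ⊆ closedBall c (2 * r) ∧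
      ∫⁻ x, ‖fderiv ℝ φ x‖ₑ ≤ C * ENNReal.ofReal r ^ m := by
  let η : ContDiffBump (0 : Eu (m + 1)) := ⟨1, 2, one_pos, one_lt_two⟩
  have hη : ContDiff ℝ (⊤ : ℕ∞) η := η.contDiff
  obtain ⟨M, hM⟩ := (η.hasCompactSupport.fderiv (𝕜 := ℝ)).exists_bound_of_continuous
    (hη.continuous_fderiv (by simp))
  refine ⟨ENNReal.ofReal M * (ENNReal.ofReal (2 ^ (m + 1)) * volume (ball (0 : Eu (m + 1)) 1)),
    by finiteness, fun c r hr => ?_⟩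
  have hsm : ContDiff ℝ (⊤ : ℕ∞) fun x => r⁻¹ • (x - c) := by fun_prop
  have hts : tsupport (fun x => η (r⁻¹ • (x - c))) ⊆ closedBall c (2 * r) := by
    refine closure_minimal (fun x hx => ?_) isClosed_closedBall
    have hx' : r⁻¹ • (x - c) ∈ Function.support η := hx
    rw [η.support_eq, mem_ball_zero_iff, norm_smul, norm_inv, Real.norm_of_nonneg hr.le,
      inv_mul_lt_iff₀ hr] at hx'
    rw [mem_closedBall, dist_eq_norm]
    change _ < r * 2 at hx'
    linarith
  refine ⟨fun x => η (r⁻¹ • (x - c)), hη.comp hsm, fun x => ⟨η.nonneg, η.le_one⟩,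
    fun x hx => η.one_of_mem_closedBall ?_, hts, ?_⟩
  · rw [mem_closedBall_zero_iff, norm_smul, norm_inv, Real.norm_of_nonneg hr.le,
      inv_mul_le_iff₀ hr]
    change _ ≤ r * 1
    rw [mem_ball, dist_eq_norm] at hx
    linarith
  · have hbound : ∀ x, ‖fderiv ℝ (fun x => η (r⁻¹ • (x - c))) x‖ₑ ≤
        (closedBall c (2 * r)).indicator (fun _ => ENNReal.ofReal (r⁻¹ * M)) x := by
      intro x
      by_cases hx : x ∈ closedBall c (2 * r)
      · rw [indicator_of_mem hx, ← ofReal_norm]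
        refine ENNReal.ofReal_le_ofReal ?_
        have hd : HasFDerivAt (fun x => η (r⁻¹ • (x - c)))
            ((fderiv ℝ η (r⁻¹ • (x - c))).comp (r⁻¹ • ContinuousLinearMap.id ℝ (Eu (m + 1)))) x :=
          ((hη.differentiable (by simp)) _).hasFDerivAt.comp x
            (((hasFDerivAt_id x).sub_const c).const_smul r⁻¹)
        rw [hd.fderiv, ContinuousLinearMap.comp_smul, norm_smul, norm_inv,
          Real.norm_of_nonneg hr.le, ContinuousLinearMap.comp_id]
        exact mul_le_mul_of_nonneg_left (hM _) (inv_nonneg.2 hr.le)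
      · have : fderiv ℝ (fun x => η (r⁻¹ • (x - c))) x = 0 :=
          image_eq_zero_of_notMem_tsupport fun h => hx (hts (tsupport_fderiv_subset ℝ h))
        simp [← ofReal_norm, this]
    refine (lintegral_mono hbound).trans ?_
    rw [lintegral_indicator_const measurableSet_closedBall,
      Measure.addHaar_closedBall _ _ (by positivity), finrank_euclideanSpace_fin]
    rw [ENNReal.ofReal_mul (by positivity), mul_pow, ENNReal.ofReal_mul (by positivity), pow_succ r,
      ENNReal.ofReal_mul (by positivity), ENNReal.ofReal_pow hr.le]
    have hinv : ENNReal.ofReal r⁻¹ * ENNReal.ofReal r = 1 := by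
      rw [← ENNReal.ofReal_mul (by positivity), inv_mul_cancel₀ hr.ne', ENNReal.ofReal_one]
    apply le_of_eq
    calc _ = (ENNReal.ofReal r⁻¹ * ENNReal.ofReal r) * (ENNReal.ofReal M *
          (ENNReal.ofReal (2 ^ (m + 1)) * volume (ball (0 : Eu (m + 1)) 1)) *
            ENNReal.ofReal r ^ m) := by ring
      _ = _ := by rw [hinv, one_mul]

/-- Finitely many smooth cutoffs `φ i` have a smooth cutoff `1 - ∏ (1 - φ i)` equal to one wherever
one of them is, with `L¹` norm of the gradient at most the sum of theirs. -/
theorem exists_cutoff_finset {n : ℕ} {ι : Type*} (s : Finset ι) (φ : ι → Eu n → ℝ)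
    (hφ : ∀ i ∈ s, ContDiff ℝ (⊤ : ℕ∞) (φ i)) (h01 : ∀ i ∈ s, ∀ x, φ i x ∈ Icc (0 : ℝ) 1) :
    ∃ ψ : Eu n → ℝ, ContDiff ℝ (⊤ : ℕ∞) ψ ∧ (∀ x, ψ x ∈ Icc (0 : ℝ) 1) ∧
      (∀ i ∈ s, ∀ x, φ i x = 1 → ψ x = 1) ∧ tsupport ψ ⊆ ⋃ i ∈ s, tsupport (φ i) ∧
      ∫⁻ x, ‖fderiv ℝ ψ x‖ₑ ≤ ∑ i ∈ s, ∫⁻ x, ‖fderiv ℝ (φ i) x‖ₑ := by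
  classical
  induction s using Finset.induction_on with
  | empty =>
    exact ⟨0, contDiff_const, by simp, by simp, by simp [tsupport], by simp [← ofReal_norm]⟩
  | insert i s hi ih =>
    obtain ⟨ψ, hψ, hψ01, hψ1, hψs, hψd⟩ := ih (fun j hj => hφ j (Finset.mem_insert_of_mem hj))
      (fun j hj => h01 j (Finset.mem_insert_of_mem hj))
    have hφi := hφ i (Finset.mem_insert_self i s)
    have hφi01 := h01 i (Finset.mem_insert_self i s)
    refine ⟨fun x => 1 - (1 - φ i x) * (1 - ψ x), by fun_prop, fun x => ?_, ?_, ?_, ?_⟩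
    · obtain ⟨h₁, h₂⟩ := hφi01 x
      obtain ⟨h₃, h₄⟩ := hψ01 x
      constructor <;> nlinarith
    · intro j hj x hx
      rcases Finset.mem_insert.1 hj with rfl | hj
      · simp [hx]
      · simp [hψ1 j hj x hx]
    · refine closure_minimal (fun x hx => ?_) ?_
      · by_contra hcon
        rw [Finset.set_biUnion_insert, mem_union, not_or] at hcon
        have h₁ := image_eq_zero_of_notMem_tsupport hcon.1
        have h₂ := image_eq_zero_of_notMem_tsupport fun h => hcon.2 (hψs h)
        exact hx (by simp [h₁, h₂])
      · exact (insert i s).finite_toSet.isClosed_biUnion fun j _ => isClosed_tsupport _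
    · have hd : ∀ x, ‖fderiv ℝ (fun x => 1 - (1 - φ i x) * (1 - ψ x)) x‖ₑ ≤
          ‖fderiv ℝ (φ i) x‖ₑ + ‖fderiv ℝ ψ x‖ₑ := by
        intro x
        have h₁ := ((hφi.differentiable (by simp)) x).hasFDerivAt
        have h₂ := ((hψ.differentiable (by simp)) x).hasFDerivAt
        have h₃ := ((h₁.const_sub 1).mul (h₂.const_sub 1)).const_sub 1
        have h₄ : fderiv ℝ (fun x => 1 - (1 - φ i x) * (1 - ψ x)) x =
            (1 - φ i x) • fderiv ℝ ψ x + (1 - ψ x) • fderiv ℝ (φ i) x := by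
          refine HasFDerivAt.fderiv (h₃.congr_fderiv ?_)
          simp only [smul_neg]
          abel
        rw [h₄, ← ofReal_norm, ← ofReal_norm, ← ofReal_norm,
          ← ENNReal.ofReal_add (norm_nonneg _) (norm_nonneg _)]
        refine ENNReal.ofReal_le_ofReal ?_
        obtain ⟨h₅, h₆⟩ := hφi01 x
        obtain ⟨h₇, h₈⟩ := hψ01 x
        refine (norm_add_le _ _).trans ?_
        rw [norm_smul, norm_smul, Real.norm_of_nonneg (by linarith),
          Real.norm_of_nonneg (by linarith), add_comm]
        exact add_le_add (mul_le_of_le_one_left (norm_nonneg _) (by linarith))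
          (mul_le_of_le_one_left (norm_nonneg _) (by linarith))
      rw [Finset.sum_insert hi]
      refine (lintegral_mono hd).trans ?_
      rw [lintegral_add_left]
      · gcongr
      · exact (hφi.continuous_fderiv (by simp)).enorm.measurable

/-- A compact `H^{n-1}`-null set has zero `W^{1,1}` capacity: it admits smooth cutoffs supported
arbitrarily close to it, with arbitrarily small `L¹` norm of the gradient. -/
theorem exists_cutoff_of_hm_eq_zero {n : ℕ} {K : Set (Eu n)} (hK : IsCompact K) (h0 : hm n K = 0)
    {δ : ℝ} (hδ : 0 < δ) {ε : ℝ≥0∞} (hε : ε ≠ 0) :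
    ∃ φ : Eu n → ℝ, ContDiff ℝ (⊤ : ℕ∞) φ ∧ (∀ x, φ x ∈ Icc (0 : ℝ) 1) ∧ (∀ x ∈ K, φ x = 1) ∧
      tsupport φ ⊆ cthickening δ K ∧ ∫⁻ x, ‖fderiv ℝ φ x‖ₑ ≤ ε := by
  cases n with
  | zero =>
    have h1 : μH[0] K = 0 :=
      le_antisymm ((Measure.hausdorffMeasure_mono (by simp) K).trans h0.le) bot_le
    have hKe : K = ∅ := by
      by_contra hne
      obtain ⟨x, hx⟩ := nonempty_iff_ne_empty.2 hne
      have := measure_mono_null (singleton_subset_iff.2 hx) h1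
      simp at this
    subst hKe
    obtain ⟨φ, hφ, h01, -, hs, hd⟩ := exists_cutoff_finset (∅ : Finset ℕ) (n := 0) (fun _ => 0)
      (by simp) (by simp)
    exact ⟨φ, hφ, h01, by simp, hs.trans (by simp), hd.trans (by simp)⟩
  | succ m =>
    obtain ⟨C, hC, hcut⟩ := exists_cutoff_ball m
    have hm0 : μH[(m : ℝ)] K = 0 := by simpa [hm] using h0
    have hεC : ε / C ≠ 0 := ENNReal.div_ne_zero.2 ⟨hε, hC⟩
    obtain ⟨s, c, r, hs, hKs, hsum⟩ := exists_finset_ball_cover_of_hausdorffMeasure_eq_zero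
      m.cast_nonneg hK hm0 (half_pos hδ) hεC
    have hcut' : ∀ i, ∃ φ : Eu (m + 1) → ℝ, i ∈ s → ContDiff ℝ (⊤ : ℕ∞) φ ∧
        (∀ x, φ x ∈ Icc (0 : ℝ) 1) ∧ (∀ x ∈ ball (c i) (r i), φ x = 1) ∧
        tsupport φ ⊆ closedBall (c i) (2 * r i) ∧
        ∫⁻ x, ‖fderiv ℝ φ x‖ₑ ≤ C * ENNReal.ofReal (r i) ^ m := by
      intro i
      by_cases hi : i ∈ s
      · obtain ⟨φ, hφ⟩ := hcut (c i) (r i) (hs i hi).2.1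
        exact ⟨φ, fun _ => hφ⟩
      · exact ⟨0, fun h => (hi h).elim⟩
    choose φ hφ using hcut'
    obtain ⟨ψ, hψ, hψ01, hψ1, hψs, hψd⟩ := exists_cutoff_finset s φ (fun i hi => (hφ i hi).1)
      (fun i hi => (hφ i hi).2.1)
    refine ⟨ψ, hψ, hψ01, fun x hx => ?_, hψs.trans (iUnion₂_subset fun i hi => ?_), hψd.trans ?_⟩
    · obtain ⟨i, hi, hxi⟩ := mem_iUnion₂.1 (hKs hx)
      exact hψ1 i hi x ((hφ i hi).2.2.1 x hxi)
    · refine ((hφ i hi).2.2.2.1.trans (closedBall_subset_closedBall ?_)).trans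
        (closedBall_subset_cthickening (hs i hi).1 δ)
      linarith [(hs i hi).2.2]
    · calc ∑ i ∈ s, ∫⁻ x, ‖fderiv ℝ (φ i) x‖ₑ
          ≤ ∑ i ∈ s, C * ENNReal.ofReal (r i) ^ m :=
            Finset.sum_le_sum fun i hi => (hφ i hi).2.2.2.2
        _ = C * ∑ i ∈ s, ENNReal.ofReal (r i) ^ (m : ℝ) := by
            simp [Finset.mul_sum]
        _ ≤ C * (ε / C) := by gcongr
        _ ≤ ε := ENNReal.mul_div_le

theorem enorm_setIntegral_inner_gradient_le {n : ℕ} {Ω L : Set (Eu n)} {σ : Eu n → Eu n} {C : ℝ}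
    (hL : MeasurableSet L) (hσ : ∀ᵐ x ∂(volume.restrict L), ‖σ x‖ ≤ C) {φ : Eu n → ℝ}
    (hφ : tsupport φ ⊆ L) :
    ‖∫ x in Ω, ⟪σ x, gradient φ x⟫‖ₑ ≤ ENNReal.ofReal C * ∫⁻ x, ‖fderiv ℝ φ x‖ₑ := by
  have hbound : ∀ᵐ x, ‖⟪σ x, gradient φ x⟫‖ₑ ≤ ENNReal.ofReal C * ‖fderiv ℝ φ x‖ₑ := by
    filter_upwards [(ae_restrict_iff' hL).1 hσ] with x hx
    have hg : ‖gradient φ x‖ = ‖fderiv ℝ φ x‖ := by simp [gradient]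
    by_cases hxL : x ∈ L
    · rw [← ofReal_norm, ← ofReal_norm,
        ← ENNReal.ofReal_mul ((norm_nonneg _).trans (hx hxL)), ← hg]
      exact ENNReal.ofReal_le_ofReal ((norm_inner_le_norm _ _).trans
        (mul_le_mul_of_nonneg_right (hx hxL) (norm_nonneg _)))
    · have h0 : fderiv ℝ φ x = 0 :=
        image_eq_zero_of_notMem_tsupport fun h => hxL (hφ (tsupport_fderiv_subset ℝ h))
      simp [gradient, h0]
  calc ‖∫ x in Ω, ⟪σ x, gradient φ x⟫‖ₑ ≤ ∫⁻ x in Ω, ‖⟪σ x, gradient φ x⟫‖ₑ :=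
        enorm_integral_le_lintegral_enorm _
    _ ≤ ∫⁻ x, ‖⟪σ x, gradient φ x⟫‖ₑ := setLIntegral_le_lintegral _ _
    _ ≤ ∫⁻ x, ENNReal.ofReal C * ‖fderiv ℝ φ x‖ₑ := lintegral_mono_ae hbound
    _ = ENNReal.ofReal C * ∫⁻ x, ‖fderiv ℝ φ x‖ₑ := lintegral_const_mul' _ _ ENNReal.ofReal_ne_top

theorem integrable_of_tsupport_subset {n : ℕ} {μ : Measure (Eu n)} {L : Set (Eu n)}
    (hμ : μ L ≠ ⊤) {φ : Eu n → ℝ} (hc : Continuous φ)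
    (h01 : ∀ x, φ x ∈ Icc (0 : ℝ) 1) (hφ : tsupport φ ⊆ L) : Integrable φ μ := by
  rw [← integrableOn_iff_integrable_of_support_subset ((subset_tsupport φ).trans hφ)]
  refine Measure.integrableOn_of_bounded (M := 1) hμ hc.aestronglyMeasurable
    (Eventually.of_forall fun x => ?_)
  rw [Real.norm_of_nonneg (h01 x).1]
  exact (h01 x).2

/-- If `-Div σ = μp - μn`, then `μp` does not charge compact `H^{n-1}`-null sets which are
`μn`-null. -/
theorem measure_eq_zero_of_isCompact_of_hm_eq_zero {n : ℕ} {Ω : Set (Eu n)} (hΩ : IsOpen Ω)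
    {σ : Eu n → Eu n} (hσ : LocBdd Ω σ) {μp μn : Measure (Eu n)}
    (hp : LocFinOn Ω μp) (hn : LocFinOn Ω μn) (hrep : RepNegDiv Ω σ μp μn)
    {K : Set (Eu n)} (hK : IsCompact K) (hKΩ : K ⊆ Ω) (h0 : hm n K = 0) (hnK : μn K = 0) :
    μp K = 0 := by
  obtain ⟨R, hR, hRΩ⟩ := hK.exists_cthickening_subset_open hΩ hKΩ
  have hLc : IsCompact (cthickening R K) := hK.cthickening
  obtain ⟨C, hC⟩ := hσ.2 _ hRΩ hLc
  have hpL := (hp.1 _ hRΩ hLc).ne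
  have hnL := (hn.1 _ hRΩ hLc).ne
  have key : ∀ δ ∈ Ioc 0 R, ∀ ε : ℝ≥0∞, ε ≠ 0 →
      μp K ≤ ENNReal.ofReal C * ε + μn (cthickening δ K) := by
    intro δ hδ ε hε
    obtain ⟨φ, hφ, h01, h1, hs, hd⟩ := exists_cutoff_of_hm_eq_zero hK h0 hδ.1 hε
    have hsL : tsupport φ ⊆ cthickening R K := hs.trans (cthickening_mono hδ.2 K)
    have hcs : HasCompactSupport φ := hLc.of_isClosed_subset (isClosed_tsupport φ) hsL
    have hip := integrable_of_tsupport_subset hpL hφ.continuous h01 hsL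
    have hin := integrable_of_tsupport_subset hnL hφ.continuous h01 hsL
    have heq := hrep φ ⟨hφ, hcs, hsL.trans hRΩ⟩
    have hKp : μp K ≤ ENNReal.ofReal (∫ x, φ x ∂μp) := by
      rw [ofReal_integral_eq_lintegral_ofReal hip (Eventually.of_forall fun x => (h01 x).1),
        ← lintegral_indicator_one hK.measurableSet]
      refine lintegral_mono (indicator_le fun y hy => ?_)
      simp [h1 y hy]
    have hLn : ENNReal.ofReal (∫ x, φ x ∂μn) ≤ μn (cthickening δ K) := by
      rw [ofReal_integral_eq_lintegral_ofReal hin (Eventually.of_forall fun x => (h01 x).1),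
        ← lintegral_indicator_one isClosed_cthickening.measurableSet]
      refine lintegral_mono fun x => ?_
      by_cases hx : x ∈ cthickening δ K
      · simpa [hx] using (h01 x).2
      · simp [image_eq_zero_of_notMem_tsupport fun h => hx (hs h)]
    have hdiv := enorm_setIntegral_inner_gradient_le (Ω := Ω) hLc.measurableSet hC hsL
    have hsplit : ∫ x, φ x ∂μp = (∫ x in Ω, ⟪σ x, gradient φ x⟫) + ∫ x, φ x ∂μn := by
      rw [heq]; ring
    rw [hsplit] at hKp
    refine hKp.trans (ENNReal.ofReal_add_le.trans (add_le_add ?_ hLn))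
    exact (Real.ofReal_le_enorm _).trans (hdiv.trans (by gcongr))
  have hthick : Tendsto (fun δ => μn (cthickening δ K)) (𝓝[>] 0) (𝓝 0) := by
    have := tendsto_measure_cthickening_of_isClosed (μ := μn) ⟨R, hR, hnL⟩ hK.isClosed
    rw [hnK] at this
    exact this.mono_left nhdsWithin_le_nhds
  have hleft : ∀ ε : ℝ≥0∞, ε ≠ 0 → μp K ≤ ENNReal.ofReal C * ε := by
    intro ε hε
    have hlim := hthick.const_add (ENNReal.ofReal C * ε)
    rw [add_zero] at hlim
    exact ge_of_tendsto hlim (mem_of_superset (Ioc_mem_nhdsGT hR) fun δ hδ => key δ hδ ε hε)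
  have hlim : Tendsto (fun ε : ℝ≥0∞ => ENNReal.ofReal C * ε) (𝓝[>] 0) (𝓝 0) := by
    have := (ENNReal.continuous_const_mul (a := ENNReal.ofReal C) ENNReal.ofReal_ne_top).tendsto 0
    rw [mul_zero] at this
    exact this.mono_left nhdsWithin_le_nhds
  refine le_antisymm (ge_of_tendsto hlim ?_) bot_le
  filter_upwards [self_mem_nhdsWithin] with ε hε using hleft ε (ne_of_gt hε)

/-- If `-Div σ = μp - μn` with `μp ⟂ μn`, then `μp` does not charge Borel `H^{n-1}`-null sets. -/
theorem measure_eq_zero_of_hm_eq_zero {n : ℕ} {Ω : Set (Eu n)} (hΩ : IsOpen Ω)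
    {σ : Eu n → Eu n} (hσ : LocBdd Ω σ) {μp μn : Measure (Eu n)}
    (hp : LocFinOn Ω μp) (hn : LocFinOn Ω μn) (hsing : μp ⟂ₘ μn) (hrep : RepNegDiv Ω σ μp μn)
    {A : Set (Eu n)} (hAΩ : A ⊆ Ω) (hA : MeasurableSet A) (h0 : hm n A = 0) : μp A = 0 := by
  obtain ⟨S, hS, hpS, hnS⟩ := hsing
  refine measure_null_of_locally_null A fun x hx => ?_
  obtain ⟨r, hr, hrΩ⟩ := nhds_basis_closedBall.mem_iff.1 (hΩ.mem_nhds (hAΩ hx))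
  refine ⟨A ∩ closedBall x r, inter_mem_nhdsWithin _ (closedBall_mem_nhds x hr), ?_⟩
  by_contra hne
  have hfin : IsFiniteMeasure (μp.restrict (closedBall x r)) :=
    ⟨by simpa using hp.1 _ hrΩ (isCompact_closedBall x r)⟩
  have hpos : 0 < μp.restrict (closedBall x r) (A ∩ Sᶜ) := by
    rw [Measure.restrict_apply (hA.inter hS.compl), pos_iff_ne_zero]
    refine fun h => hne (measure_mono_null ?_ (measure_union_null h hpS))
    rintro y ⟨hyA, hyr⟩
    by_cases hyS : y ∈ S
    · exact Or.inr hyS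
    · exact Or.inl ⟨⟨hyA, hyS⟩, hyr⟩
  obtain ⟨K, hKA, hK, hKpos⟩ := (hA.inter hS.compl).exists_lt_isCompact hpos
  have hKA' : K ⊆ A := hKA.trans inter_subset_left
  have := measure_eq_zero_of_isCompact_of_hm_eq_zero hΩ hσ hp hn hrep hK (hKA'.trans hAΩ)
    (measure_mono_null hKA' h0) (measure_mono_null (hKA.trans inter_subset_right) hnS)
  exact hKpos.ne' (Measure.absolutelyContinuous_of_le Measure.restrict_le_self this)

/-- Chen–Frid absolute continuity: if `σ ∈ L^∞_loc(Ω,ℝⁿ)` has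
divergence representable by a signed Radon measure `μn - μp` (so `-Div σ = μp - μn`,
with `μp ⟂ μn`, i.e. `|Div σ| = μp + μn`), then `|Div σ|` vanishes on every Borel
set `A ⊆ Ω` with `H^{n-1}(A) = 0`. -/
theorem stmt0 {n : ℕ} (Ω : Set (Eu n)) (hΩ : IsOpen Ω) (σ : Eu n → Eu n)
    (hσ : LocBdd Ω σ) (μp μn : Measure (Eu n))
    (hp : LocFinOn Ω μp) (hn : LocFinOn Ω μn) (hsing : μp ⟂ₘ μn)
    (hrep : RepNegDiv Ω σ μp μn) :
    ∀ A : Set (Eu n), A ⊆ Ω → MeasurableSet A → hm n A = 0 → μp A = 0 ∧ μn A = 0 := by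
  intro A hAΩ hA h0
  have hσ' : LocBdd Ω (-σ) := ⟨hσ.1.neg, by simpa using hσ.2⟩
  have hrep' : RepNegDiv Ω (-σ) μn μp := fun φ hφ => by
    simp only [Pi.neg_apply, inner_neg_left, integral_neg, hrep φ hφ, neg_sub]
  exact ⟨measure_eq_zero_of_hm_eq_zero hΩ hσ hp hn hsing hrep hAΩ hA h0,
    measure_eq_zero_of_hm_eq_zero hΩ hσ' hn hp hsing.symm hrep' hAΩ hA h0⟩
end
end

section
/- Let Ω ⊂ ℝⁿ be open with H^{n-1}(∂Ω) < ∞. Then for every u ∈ BV(Ω) ∩ L^∞(Ω), the extension by zero 𝟙_Ω u belongs to BV(ℝⁿ), and the total variation of its gradient measure on the boundary satisfies |D(𝟙_Ω u)|(∂Ω) ≤ (n ω_n / ω_{n-1}) ‖u‖_{L^∞(Ω)} H^{n-1}(∂Ω). In particular, Ω is a set of finite perimeter in ℝⁿ. -/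
open MeasureTheory Set Filter Topology Metric
open scoped RealInnerProductSpace ENNReal

noncomputable section

/-- The total variation of a smooth monotone transition from `0` to `1` is one. -/
theorem integral_abs_deriv_smoothTransition :
    Integrable (fun t => |deriv Real.smoothTransition t|) ∧
    ∫ t, |deriv Real.smoothTransition t| = 1 := by
  have hc : ContDiff ℝ 1 Real.smoothTransition := Real.smoothTransition.contDiff (n := 1)
  have hnn : ∀ t, 0 ≤ deriv Real.smoothTransition t :=
    fun t => Real.smoothTransition.monotone.deriv_nonneg
  have habs : (fun t => |deriv Real.smoothTransition t|) = deriv Real.smoothTransition :=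
    funext fun t => abs_of_nonneg (hnn t)
  have hd : ∀ t, HasDerivAt Real.smoothTransition (deriv Real.smoothTransition t) t :=
    fun t => (hc.differentiable one_ne_zero t).hasDerivAt
  have hbot : Tendsto Real.smoothTransition atBot (𝓝 0) :=
    tendsto_const_nhds.congr' ((eventually_le_atBot 0).mono fun t ht =>
      (Real.smoothTransition.zero_of_nonpos ht).symm)
  have htop : Tendsto Real.smoothTransition atTop (𝓝 1) :=
    tendsto_const_nhds.congr' ((eventually_ge_atTop 1).mono fun t ht =>
      (Real.smoothTransition.one_of_one_le ht).symm)
  have hsupp : HasCompactSupport (deriv Real.smoothTransition) := by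
    refine HasCompactSupport.intro (isCompact_Icc (a := 0) (b := 1)) fun t ht => ?_
    rw [mem_Icc, not_and_or, not_le, not_le] at ht
    rcases ht with ht | ht
    · have : Real.smoothTransition =ᶠ[𝓝 t] fun _ => 0 := by
        filter_upwards [eventually_lt_nhds ht] with y hy
        exact Real.smoothTransition.zero_of_nonpos hy.le
      rw [this.deriv_eq, deriv_const]
    · have : Real.smoothTransition =ᶠ[𝓝 t] fun _ => 1 := by
        filter_upwards [eventually_gt_nhds ht] with y hy
        exact Real.smoothTransition.one_of_one_le hy.le
      rw [this.deriv_eq, deriv_const]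
  have hderiv_int : Integrable (deriv Real.smoothTransition) :=
    (hc.continuous_deriv le_rfl).integrable_of_hasCompactSupport hsupp
  rw [habs]
  refine ⟨hderiv_int, ?_⟩
  rw [integral_of_hasDerivAt_of_tendsto hd hderiv_int hbot htop, sub_zero]

/-- A smooth plateau function on an interval whose derivative has `L¹` norm at most two. -/
theorem exists_plateau (a b ρ : ℝ) (hρ : 0 < ρ) :
    ∃ f : ℝ → ℝ, ContDiff ℝ (⊤ : ℕ∞) f ∧ (∀ t, 0 ≤ f t) ∧ (∀ t, f t ≤ 1) ∧
      (∀ t ∈ Icc a b, f t = 1) ∧ (∀ t, t ∉ Icc (a - ρ) (b + ρ) → f t = 0) ∧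
      ∫ t, |deriv f t| ≤ 2 := by
  have hc : ContDiff ℝ (⊤ : ℕ∞) Real.smoothTransition :=
    Real.smoothTransition.contDiff (n := (⊤ : ℕ∞))
  have hc1 : Differentiable ℝ Real.smoothTransition := hc.differentiable (by simp)
  have hl : ContDiff ℝ (⊤ : ℕ∞) (fun t : ℝ => ρ⁻¹ * t + (1 - ρ⁻¹ * a)) := by fun_prop
  have hr : ContDiff ℝ (⊤ : ℕ∞) (fun t : ℝ => (-ρ⁻¹) * t + (1 + ρ⁻¹ * b)) := by fun_prop
  refine ⟨fun t => Real.smoothTransition (ρ⁻¹ * t + (1 - ρ⁻¹ * a)) *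
    Real.smoothTransition ((-ρ⁻¹) * t + (1 + ρ⁻¹ * b)), (hc.comp hl).mul (hc.comp hr), fun t => ?_,
    fun t => ?_, fun t ht => ?_, fun t ht => ?_, ?_⟩
  · exact mul_nonneg (Real.smoothTransition.nonneg _) (Real.smoothTransition.nonneg _)
  · exact mul_le_one₀ (Real.smoothTransition.le_one _) (Real.smoothTransition.nonneg _)
      (Real.smoothTransition.le_one _)
  · have h1 : 0 ≤ ρ⁻¹ * (t - a) := mul_nonneg (inv_pos.2 hρ).le (sub_nonneg.2 ht.1)
    have h2 : 0 ≤ ρ⁻¹ * (b - t) := mul_nonneg (inv_pos.2 hρ).le (sub_nonneg.2 ht.2)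
    dsimp only
    rw [Real.smoothTransition.one_of_one_le (by linarith),
      Real.smoothTransition.one_of_one_le (by linarith), one_mul]
  · rw [mem_Icc, not_and_or, not_le, not_le] at ht
    have h1 : ρ⁻¹ * ρ = 1 := inv_mul_cancel₀ hρ.ne'
    rcases ht with ht | ht
    · have h2 : 0 ≤ ρ⁻¹ * (a - ρ - t) := mul_nonneg (inv_pos.2 hρ).le (by linarith)
      dsimp only
      rw [Real.smoothTransition.zero_of_nonpos (by linarith), zero_mul]
    · have h2 : 0 ≤ ρ⁻¹ * (t - (b + ρ)) := mul_nonneg (inv_pos.2 hρ).le (by linarith)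
      dsimp only
      rw [mul_comm, Real.smoothTransition.zero_of_nonpos (by linarith), zero_mul]
  · have hdl : ∀ m c t : ℝ, HasDerivAt (fun t => Real.smoothTransition (m * t + c))
        (deriv Real.smoothTransition (m * t + c) * m) t := fun m c t => by
      have h := ((hasDerivAt_id t).const_mul m).add_const c
      simp only [id, mul_one] at h
      exact (hc1 _).hasDerivAt.comp t h
    obtain ⟨hderiv_int, hval⟩ := integral_abs_deriv_smoothTransition
    have hI : ∀ m c : ℝ, m ≠ 0 →
        Integrable (fun t => |deriv Real.smoothTransition (m * t + c) * m|) ∧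
        ∫ t, |deriv Real.smoothTransition (m * t + c) * m| = 1 := fun m c hm => by
      have h1 : Integrable (fun t => |deriv Real.smoothTransition (m * t + c)|) :=
        (hderiv_int.comp_add_right c).comp_mul_left' hm
      simp only [abs_mul]
      refine ⟨h1.mul_const _, ?_⟩
      rw [integral_mul_const,
        Measure.integral_comp_mul_left (fun t => |deriv Real.smoothTransition (t + c)|) m,
        integral_add_right_eq_self (fun t => |deriv Real.smoothTransition t|) c, hval, abs_inv,
        smul_eq_mul, mul_one, inv_mul_cancel₀ (abs_ne_zero.2 hm)]
    have hm : ρ⁻¹ ≠ 0 := inv_ne_zero hρ.ne'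
    have h1 := hI ρ⁻¹ (1 - ρ⁻¹ * a) hm
    have h2 := hI (-ρ⁻¹) (1 + ρ⁻¹ * b) (neg_ne_zero.2 hm)
    calc _ ≤ ∫ t, (|deriv Real.smoothTransition (ρ⁻¹ * t + (1 - ρ⁻¹ * a)) * ρ⁻¹| +
          |deriv Real.smoothTransition ((-ρ⁻¹) * t + (1 + ρ⁻¹ * b)) * (-ρ⁻¹)|) := by
          refine integral_mono_of_nonneg (ae_of_all _ fun t => abs_nonneg _) (h1.1.add h2.1)
            (ae_of_all _ fun t => ?_)
          dsimp only
          rw [((hdl ρ⁻¹ _ t).fun_mul (hdl (-ρ⁻¹) _ t)).deriv]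
          refine (abs_add_le _ _).trans (add_le_add ?_ ?_)
          · rw [abs_mul]
            exact mul_le_of_le_one_right (abs_nonneg _)
              (by rw [abs_of_nonneg (Real.smoothTransition.nonneg _)]
                  exact Real.smoothTransition.le_one _)
          · rw [abs_mul]
            exact mul_le_of_le_one_left (abs_nonneg _)
              (by rw [abs_of_nonneg (Real.smoothTransition.nonneg _)]
                  exact Real.smoothTransition.le_one _)
      _ = 2 := by rw [integral_add h1.1 h2.1, h1.2, h2.2]; norm_num

/-- Coordinate projections of a bounded set lie in intervals of length its diameter. -/
theorem exists_coord_interval {n : ℕ} {t : Set (Eu n)} (hb : Bornology.IsBounded t)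
    (hne : t.Nonempty) (i : Fin n) : ∃ a : ℝ, ∀ y ∈ t, a ≤ y i ∧ y i ≤ a + diam t := by
  have key : ∀ y ∈ t, ∀ z ∈ t, y i - diam t ≤ z i := fun y hy z hz => by
    have h1 : ‖(y - z) i‖ ≤ ‖y - z‖ := PiLp.norm_apply_le (y - z) i
    have h2 : ‖y - z‖ ≤ diam t := by rw [← dist_eq_norm]; exact dist_le_diam_of_mem hb hy hz
    have h3 := (le_abs_self _).trans (h1.trans h2)
    simp only [PiLp.sub_apply] at h3
    linarith
  obtain ⟨y₀, hy₀⟩ := hne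
  refine ⟨sInf ((fun y : Eu n => y i) '' t), fun y hy => ⟨csInf_le ⟨y₀ i - diam t, ?_⟩ ⟨y, hy, rfl⟩,
    sub_le_iff_le_add.1 (le_csInf ⟨_, y₀, hy₀, rfl⟩ ?_)⟩⟩
  · rintro _ ⟨z, hz, rfl⟩; exact key _ hy₀ _ hz
  · rintro _ ⟨z, hz, rfl⟩; exact key _ hy _ hz

/-- Partial derivative of a tensor product of functions of one variable. -/
theorem fderiv_prod_coord {n : ℕ} (f : Fin n → ℝ → ℝ) (hf : ∀ i, Differentiable ℝ (f i))
    (j : Fin n) (x : Eu n) :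
    fderiv ℝ (fun y : Eu n => ∏ i, f i (y i)) x (EuclideanSpace.single j 1) =
      ∏ i, (if i = j then deriv (f i) (x i) else f i (x i)) := by
  have h : ∀ i ∈ (Finset.univ : Finset (Fin n)), HasFDerivAt (fun y : Eu n => f i (y i))
      (deriv (f i) (x i) • (EuclideanSpace.proj i : Eu n →L[ℝ] ℝ)) x := fun i _ =>
    (hf i (x i)).hasDerivAt.comp_hasFDerivAt x (EuclideanSpace.proj i : Eu n →L[ℝ] ℝ).hasFDerivAt
  rw [(HasFDerivAt.finsetProd h).fderiv]
  simp only [_root_.sum_apply, _root_.smul_apply, smul_eq_mul,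
    EuclideanSpace.coe_proj, PiLp.single_apply]
  rw [Finset.sum_eq_single j (fun i _ hi => by simp [hi]) (by simp),
    ← Finset.mul_prod_erase Finset.univ _ (Finset.mem_univ j)]
  simp only [if_true, mul_one]
  rw [mul_comm]
  congr 1
  exact Finset.prod_congr rfl fun i hi => by rw [if_neg (Finset.ne_of_mem_erase hi)]

/-- A smooth cutoff of a set of diameter less than `s`, supported in a box of side `s` and
with the expected bound on one of its partial derivatives. -/
theorem exists_box_bump {n : ℕ} (j : Fin n) {t : Set (Eu n)} (hne : t.Nonempty) {s : ℝ}
    (hb : Bornology.IsBounded t) (hs : diam t < s) :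
    ∃ ψ : Eu n → ℝ, ContDiff ℝ (⊤ : ℕ∞) ψ ∧ (∀ x, 0 ≤ ψ x) ∧ (∀ x, ψ x ≤ 1) ∧
      (∃ V, IsOpen V ∧ t ⊆ V ∧ ∀ x ∈ V, ψ x = 1) ∧
      (∀ x, ψ x ≠ 0 → ∀ y ∈ t, dist x y ≤ n * s) ∧
      ∫⁻ x, ‖fderiv ℝ ψ x (EuclideanSpace.single j 1)‖ₑ ≤ 2 * ENNReal.ofReal s ^ (n - 1) ∧
      volume (Function.support ψ) ≤ ENNReal.ofReal s ^ n := by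
  have hs0 : 0 < s := diam_nonneg.trans_lt hs
  choose a ha using exists_coord_interval hb hne
  set ρ := (s - diam t) / 4 with hρ
  have hρ0 : 0 < ρ := by rw [hρ]; linarith
  choose f hfc hf0 hf1 hfone hfz hfd using
    fun i => exists_plateau (a i - ρ) (a i + diam t + ρ) ρ hρ0
  have hlen : ∀ i, (a i + diam t + ρ + ρ) - (a i - ρ - ρ) = s := fun i => by rw [hρ]; ring
  have hfdiff : ∀ i, Differentiable ℝ (f i) := fun i => (hfc i).differentiable (by simp)
  have hfsupp : ∀ i, HasCompactSupport (f i) := fun i =>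
    HasCompactSupport.intro isCompact_Icc fun t ht => hfz i t ht
  have hmem : ∀ x : Eu n, ∏ i, f i (x i) ≠ 0 →
      ∀ i, x i ∈ Icc (a i - ρ - ρ) (a i + diam t + ρ + ρ) := fun x hx i => by
    by_contra h
    exact hx (Finset.prod_eq_zero (Finset.mem_univ i) (hfz i _ h))
  refine ⟨fun x => ∏ i, f i (x i), contDiff_prod fun i _ => (hfc i).comp (by fun_prop),
    fun x => Finset.prod_nonneg fun i _ => hf0 i _,
    fun x => Finset.prod_le_one (fun i _ => hf0 i _) fun i _ => hf1 i _,
    ⟨⋂ i, {x : Eu n | x i ∈ Ioo (a i - ρ) (a i + diam t + ρ)},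
      isOpen_iInter_of_finite fun i => isOpen_Ioo.preimage (by fun_prop), fun y hy => ?_,
      fun x hx => ?_⟩, fun x hx y hy => ?_, ?_, ?_⟩
  · rw [mem_iInter]
    intro i
    have := ha i y hy
    exact ⟨by linarith, by linarith⟩
  · rw [mem_iInter] at hx
    exact Finset.prod_eq_one fun i _ => hfone i _ (Ioo_subset_Icc_self (hx i))
  · have h1 : ∀ i, dist (x i) (y i) ^ 2 ≤ s ^ 2 := fun i => by
      refine pow_le_pow_left₀ dist_nonneg ?_ 2
      have h2 := hmem x hx i
      have h3 := ha i y hy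
      have h4 := hlen i
      rw [Real.dist_eq, abs_le]
      exact ⟨by linarith [h2.1], by linarith [h2.2]⟩
    rw [EuclideanSpace.dist_eq]
    refine Real.sqrt_le_iff.2 ⟨by positivity, (Finset.sum_le_sum fun i _ => h1 i).trans ?_⟩
    rw [Finset.sum_const, Finset.card_univ, Fintype.card_fin, nsmul_eq_mul, mul_pow]
    refine mul_le_mul_of_nonneg_right ?_ (sq_nonneg s)
    exact_mod_cast Nat.le_self_pow two_ne_zero n
  · simp only [fderiv_prod_coord f hfdiff]
    set F : Fin n → ℝ → ℝ := fun i t => if i = j then |deriv (f i) t| else f i t with hF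
    have hFint : ∀ i, Integrable (F i) := fun i => by
      by_cases h : i = j
      · simp only [hF, h, if_true]
        exact (((hfc j).continuous_deriv (by simp)).integrable_of_hasCompactSupport
          (hfsupp j).deriv).abs
      · simp only [hF, h, if_false]
        exact (hfc i).continuous.integrable_of_hasCompactSupport (hfsupp i)
    have hF0 : ∀ i t, 0 ≤ F i t := fun i t => by
      by_cases h : i = j
      · simp only [hF, h, if_true]; exact abs_nonneg _
      · simp only [hF, h, if_false]; exact hf0 i t
    have hFle : ∀ i, ∫ t, F i t ≤ if i = j then 2 else s := fun i => by
      by_cases h : i = j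
      · simp only [hF, h, if_true]; exact hfd j
      · simp only [hF, h, if_false]
        have : ∫ r, f i r ≤
            ∫ r, (Icc (a i - ρ - ρ) (a i + diam t + ρ + ρ)).indicator 1 r := by
          refine integral_mono ((hfc i).continuous.integrable_of_hasCompactSupport (hfsupp i))
            ((integrable_indicator_iff measurableSet_Icc).2
              continuousOn_const.integrableOn_Icc) fun r => ?_
          by_cases hr : r ∈ Icc (a i - ρ - ρ) (a i + diam t + ρ + ρ)
          · simpa [indicator_of_mem hr] using hf1 i r
          · simp [indicator_of_notMem hr, hfz i r hr]
        refine this.trans (le_of_eq ?_)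
        rw [integral_indicator_one measurableSet_Icc, Measure.real, Real.volume_Icc, hlen,
          ENNReal.toReal_ofReal hs0.le]
    have heq : ∀ x : Eu n, ‖∏ i, (if i = j then deriv (f i) (x i) else f i (x i))‖ₑ =
        ENNReal.ofReal (∏ i, F i (x i)) := fun x => by
      rw [← ofReal_norm, Real.norm_eq_abs, Finset.abs_prod]
      congr 1
      refine Finset.prod_congr rfl fun i _ => ?_
      by_cases h : i = j
      · simp [hF, h]
      · simp [hF, h, abs_of_nonneg (hf0 i _)]
    have hFI : Integrable (fun x : Eu n => ∏ i, F i (x i)) :=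
      (PiLp.volume_preserving_ofLp (Fin n)).integrable_comp_of_integrable
        (g := fun x : Fin n → ℝ => ∏ i, F i (x i)) (Integrable.fintype_prod hFint)
    simp only [heq]
    rw [← ofReal_integral_eq_lintegral_ofReal hFI
      (ae_of_all _ fun x => Finset.prod_nonneg fun i _ => hF0 i _)]
    have hval : ∫ x : Eu n, ∏ i, F i (x i) = ∏ i, ∫ t, F i t := by
      rw [← integral_fintype_prod_volume_eq_prod]
      exact (PiLp.volume_preserving_ofLp (Fin n)).integral_comp
        (MeasurableEquiv.toLp 2 (Fin n → ℝ)).symm.measurableEmbedding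
        (fun x : Fin n → ℝ => ∏ i, F i (x i))
    rw [hval]
    have h2 : ∏ i, ∫ t, F i t ≤ 2 * s ^ (n - 1) := by
      refine (Finset.prod_le_prod (fun i _ => integral_nonneg (hF0 i)) fun i _ => hFle i).trans ?_
      rw [← Finset.mul_prod_erase Finset.univ _ (Finset.mem_univ j), if_pos rfl,
        Finset.prod_congr rfl fun i hi => if_neg (Finset.ne_of_mem_erase hi), Finset.prod_const,
        Finset.card_erase_of_mem (Finset.mem_univ j), Finset.card_univ, Fintype.card_fin]
    refine (ENNReal.ofReal_le_ofReal h2).trans (le_of_eq ?_)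
    rw [ENNReal.ofReal_mul zero_le_two, ENNReal.ofReal_pow hs0.le, ENNReal.ofReal_ofNat]
  · calc volume (Function.support fun x : Eu n => ∏ i, f i (x i))
        ≤ volume ((@WithLp.ofLp 2 (Fin n → ℝ)) ⁻¹'
          (Set.pi univ fun i => Icc (a i - ρ - ρ) (a i + diam t + ρ + ρ))) :=
          measure_mono fun x hx i _ => hmem x hx i
      _ = ENNReal.ofReal s ^ n := by
          rw [(PiLp.volume_preserving_ofLp (Fin n)).measure_preimage
            (MeasurableSet.univ_pi fun i => measurableSet_Icc).nullMeasurableSet, volume_pi_pi]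
          simp only [Real.volume_Icc, hlen, Finset.prod_const, Finset.card_univ, Fintype.card_fin]

/-- A set is covered with small diameters and almost optimal sum of powers of diameters. -/
theorem exists_cover_of_hm_ne_top {n : ℕ} (hn : 1 ≤ n) {E : Set (Eu n)} (hE : hm n E ≠ ⊤)
    {r ε : ℝ≥0∞} (hr : 0 < r) (hε : ε ≠ 0) :
    ∃ t : ℕ → Set (Eu n), E ⊆ ⋃ i, t i ∧ (∀ i, ediam (t i) ≤ r) ∧
      ∑' i, (⨆ _ : (t i).Nonempty, ediam (t i) ^ (n - 1)) < hm n E + ε := by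
  have h1 : (⨅ (t : ℕ → Set (Eu n)) (_ : E ⊆ ⋃ i, t i) (_ : ∀ i, ediam (t i) ≤ r),
      ∑' i, ⨆ _ : (t i).Nonempty, ediam (t i) ^ ((n : ℝ) - 1)) < hm n E + ε := by
    refine lt_of_le_of_lt ?_ (ENNReal.lt_add_right hE hε)
    rw [hm, Measure.hausdorffMeasure_apply]
    exact le_iSup₂_of_le r hr le_rfl
  have hcast : (n : ℝ) - 1 = ((n - 1 : ℕ) : ℝ) := by rw [Nat.cast_sub hn, Nat.cast_one]
  simp only [iInf_lt_iff, hcast, ENNReal.rpow_natCast] at h1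
  obtain ⟨t, ht, hd, hsum⟩ := h1
  exact ⟨t, ht, hd, hsum⟩

/-- A cutoff of a small set on which a uniformly continuous function is at most `c`. -/
theorem exists_weighted_bump {n : ℕ} (hn : 1 ≤ n) (j : Fin n) {φ : Eu n → ℝ} {t : Set (Eu n)}
    {c τ : NNReal} {δ : ℝ} (hδ : 0 < δ) (hφ : ∀ x y, dist x y ≤ n * δ → |φ x - φ y| ≤ τ)
    (hc : ∀ x ∈ t, |φ x| ≤ c) (htd : ediam t ≤ ENNReal.ofReal (δ / 2)) {ε : NNReal} (hε : 0 < ε) :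
    ∃ ψ : Eu n → ℝ, ∃ V : Set (Eu n), ContDiff ℝ (⊤ : ℕ∞) ψ ∧ (∀ x, 0 ≤ ψ x) ∧ (∀ x, ψ x ≤ 1) ∧
      IsOpen V ∧ t ⊆ V ∧ (∀ x ∈ V, ψ x = 1) ∧
      ∫⁻ x, ‖φ x‖ₑ * ‖fderiv ℝ ψ x (EuclideanSpace.single j 1)‖ₑ ≤
        (c + τ) * (2 * ((⨆ _ : t.Nonempty, ediam t ^ (n - 1)) + ε)) ∧
      volume (Function.support ψ) ≤
        ENNReal.ofReal δ * ((⨆ _ : t.Nonempty, ediam t ^ (n - 1)) + ε) := by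
  rcases t.eq_empty_or_nonempty with rfl | hne
  · exact ⟨fun _ => 0, ∅, contDiff_const, by simp, by simp, isOpen_empty, subset_rfl, by simp,
      by simp, by simp [Function.support_fun_zero]⟩
  have hfin : ediam t ≠ ⊤ := ne_top_of_le_ne_top ENNReal.ofReal_ne_top htd
  have hb : Bornology.IsBounded t := isBounded_iff_ediam_ne_top.2 hfin
  have hdiam : diam t < δ := by
    have : diam t ≤ δ / 2 := ENNReal.toReal_le_of_le_ofReal (by positivity) htd
    linarith
  obtain ⟨s, hs1, hs2, hs3⟩ : ∃ s, diam t < s ∧ s < δ ∧ s ^ (n - 1) < diam t ^ (n - 1) + ε := by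
    have hcont : Tendsto (fun s : ℝ => s ^ (n - 1)) (𝓝[>] (diam t)) (𝓝 (diam t ^ (n - 1))) :=
      ((continuous_pow (n - 1)).tendsto _).mono_left nhdsWithin_le_nhds
    have h1 : ∀ᶠ s in 𝓝[>] (diam t), diam t < s := self_mem_nhdsWithin
    have h2 : ∀ᶠ s in 𝓝[>] (diam t), s < δ :=
      (eventually_lt_nhds hdiam).filter_mono nhdsWithin_le_nhds
    have h3 := hcont.eventually_lt_const (lt_add_of_pos_right _ (NNReal.coe_pos.2 hε))
    exact (h1.and (h2.and h3)).exists
  have hs0 : 0 ≤ s := diam_nonneg.trans hs1.le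
  have hpow : ENNReal.ofReal s ^ (n - 1) ≤ (⨆ _ : t.Nonempty, ediam t ^ (n - 1)) + ε := by
    rw [iSup_pos hne, ← ENNReal.ofReal_pow hs0]
    refine (ENNReal.ofReal_le_ofReal hs3.le).trans ?_
    rw [ENNReal.ofReal_add (pow_nonneg diam_nonneg _) ε.coe_nonneg, ENNReal.ofReal_pow diam_nonneg,
      ENNReal.ofReal_coe_nnreal, diam, ENNReal.ofReal_toReal hfin]
  obtain ⟨ψ, h1, h2, h3, ⟨V, hV, htV, hψV⟩, hd, hderiv_int, hvol⟩ := exists_box_bump j hne hb hs1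
  refine ⟨ψ, V, h1, h2, h3, hV, htV, hψV, ?_, ?_⟩
  · have hle : ∀ x, ‖φ x‖ₑ * ‖fderiv ℝ ψ x (EuclideanSpace.single j 1)‖ₑ ≤
        (c + τ) * ‖fderiv ℝ ψ x (EuclideanSpace.single j 1)‖ₑ := fun x => by
      by_cases hx : ψ x = 0
      · have hmin : IsLocalMin ψ x := Eventually.of_forall fun y => hx ▸ h2 y
        simp [hmin.fderiv_eq_zero]
      · gcongr
        obtain ⟨y, hy⟩ := hne
        have h4 := hφ x y ((hd x hx y hy).trans (by gcongr))
        have h5 : |φ x| ≤ c + τ := by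
          have := abs_add_le (φ y) (φ x - φ y)
          rw [add_sub_cancel] at this
          linarith [hc y hy]
        rw [← ofReal_norm, Real.norm_eq_abs]
        refine (ENNReal.ofReal_le_ofReal h5).trans (le_of_eq ?_)
        rw [← NNReal.coe_add, ENNReal.ofReal_coe_nnreal, ENNReal.coe_add]
    refine (lintegral_mono hle).trans ?_
    rw [lintegral_const_mul' _ _ (by finiteness)]
    gcongr
    exact hderiv_int.trans (by gcongr)
  · refine hvol.trans ?_
    obtain ⟨m, rfl⟩ : ∃ m, n = m + 1 := ⟨n - 1, by omega⟩
    rw [pow_succ, mul_comm]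
    exact mul_le_mul' (ENNReal.ofReal_le_ofReal hs2.le) hpow

/-- Cutoffs of a set on which a uniformly continuous function is at most `c`. -/
theorem exists_bumps {n : ℕ} (hn : 1 ≤ n) (j : Fin n) {φ : Eu n → ℝ} (hφ : UniformContinuous φ)
    {E : Set (Eu n)} (hE : hm n E ≠ ⊤) {c τ : NNReal} (hτ : 0 < τ) (hc : ∀ x ∈ E, |φ x| ≤ c)
    {ε : NNReal} (hε : 0 < ε) :
    ∃ ψ : ℕ → Eu n → ℝ, ∃ V : ℕ → Set (Eu n), (∀ i, ContDiff ℝ (⊤ : ℕ∞) (ψ i)) ∧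
      (∀ i x, 0 ≤ ψ i x) ∧ (∀ i x, ψ i x ≤ 1) ∧ (∀ i, IsOpen (V i)) ∧ E ⊆ ⋃ i, V i ∧
      (∀ i, ∀ x ∈ V i, ψ i x = 1) ∧
      ∑' i, ∫⁻ x, ‖φ x‖ₑ * ‖fderiv ℝ (ψ i) x (EuclideanSpace.single j 1)‖ₑ ≤
        2 * (c + τ) * hm n E + ε ∧
      ∑' i, volume (Function.support (ψ i)) ≤ ε := by
  set H : NNReal := (hm n E).toNNReal with hH
  have hHE : hm n E = H := (ENNReal.coe_toNNReal hE).symm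
  set ε' : NNReal := ε / (4 * (c + τ)) with hε'
  have hcτ : 0 < c + τ := by positivity
  have hε'0 : 0 < ε' := by positivity
  obtain ⟨δ₀, hδ₀, hδφ⟩ := Metric.uniformContinuous_iff.1 hφ τ (NNReal.coe_pos.2 hτ)
  set δ : ℝ := min (δ₀ / (2 * n)) (ε / (H + 2 * ε')) with hδ
  have hn0 : (0 : ℝ) < n := by exact_mod_cast hn
  have hε'r : (0 : ℝ) < ε' := hε'0
  have hεr : (0 : ℝ) < ε := hε
  have hHr : (0 : ℝ) ≤ H := H.2
  have hδ0 : 0 < δ := lt_min (by positivity) (by positivity)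
  have hosc : ∀ x y, dist x y ≤ n * δ → |φ x - φ y| ≤ τ := fun x y hxy => by
    refine (hδφ (hxy.trans_lt ?_)).le
    calc n * δ ≤ n * (δ₀ / (2 * n)) := by gcongr; exact min_le_left _ _
      _ = δ₀ / 2 := by field_simp
      _ < δ₀ := half_lt_self hδ₀
  obtain ⟨t, hEt, htd, hsum⟩ := exists_cover_of_hm_ne_top hn hE
    (r := ENNReal.ofReal (δ / 2)) (ENNReal.ofReal_pos.2 (half_pos hδ0))
    (ENNReal.coe_ne_zero.2 hε'0.ne')
  obtain ⟨η, hη0, hηsum⟩ := ENNReal.exists_pos_sum_of_countable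
    (ENNReal.coe_ne_zero.2 hε'0.ne') ℕ
  choose ψ V h1 h2 h3 h4 h5 h6 h7 h8 using fun i =>
    exists_weighted_bump hn j (t := t i ∩ E) hδ0 hosc (fun x hx => hc x hx.2)
      ((ediam_mono inter_subset_left).trans (htd i)) (hη0 i)
  have hmono : ∀ i, (⨆ _ : (t i ∩ E).Nonempty, ediam (t i ∩ E) ^ (n - 1)) ≤
      ⨆ _ : (t i).Nonempty, ediam (t i) ^ (n - 1) := fun i =>
    iSup_le fun h => le_iSup_of_le h.left (pow_le_pow_left' (ediam_mono inter_subset_left) _)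
  have htot : ∑' i, ((⨆ _ : (t i ∩ E).Nonempty, ediam (t i ∩ E) ^ (n - 1)) + (η i : ℝ≥0∞)) ≤
      H + 2 * ε' := by
    rw [ENNReal.tsum_add, two_mul, ← add_assoc, ← hHE]
    exact add_le_add ((ENNReal.tsum_le_tsum hmono).trans hsum.le) hηsum.le
  refine ⟨ψ, V, h1, h2, h3, h4, fun x hx => ?_, h6, ?_, ?_⟩
  · obtain ⟨i, hi⟩ := mem_iUnion.1 (hEt hx)
    exact mem_iUnion.2 ⟨i, h5 i ⟨hi, hx⟩⟩
  · refine (ENNReal.tsum_le_tsum h7).trans ?_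
    rw [ENNReal.tsum_mul_left, ENNReal.tsum_mul_left]
    calc _ ≤ ((c : ℝ≥0∞) + τ) * (2 * (H + 2 * ε')) := by gcongr
      _ = 2 * (c + τ) * hm n E + ε := by
        rw [hHE]
        norm_cast
        rw [hε']
        field_simp
        ring
  · refine (ENNReal.tsum_le_tsum h8).trans ?_
    rw [ENNReal.tsum_mul_left]
    calc _ ≤ ENNReal.ofReal (ε / (H + 2 * ε')) * (H + 2 * ε') := by
          gcongr
          exact min_le_right _ _
      _ = ε := by
        have : (ε : ℝ) / (H + 2 * ε') = ((ε / (H + 2 * ε') : NNReal) : ℝ) := by push_cast; rfl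
        rw [this, ENNReal.ofReal_coe_nnreal]
        norm_cast
        exact div_mul_cancel₀ _ (by positivity)

/-- A smooth cutoff vanishing near a compact set of finite `(n-1)`-dimensional measure, with
control of the weighted `L¹` norm of a partial derivative. -/
theorem exists_cutoff {n : ℕ} (hn : 1 ≤ n) (j : Fin n) {φ : Eu n → ℝ} (hφ : UniformContinuous φ)
    {K : Set (Eu n)} (hK : IsCompact K) (hKfin : hm n K ≠ ⊤) {ε : NNReal} (hε : 0 < ε) :
    ∃ η : Eu n → ℝ, ContDiff ℝ (⊤ : ℕ∞) η ∧ (∀ x, 0 ≤ η x) ∧ (∀ x, η x ≤ 1) ∧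
      (∃ V, IsOpen V ∧ K ⊆ V ∧ ∀ x ∈ V, η x = 0) ∧
      ∫⁻ x, ‖φ x‖ₑ * ‖fderiv ℝ η x (EuclideanSpace.single j 1)‖ₑ ≤
        2 * ∫⁻ x in K, ‖φ x‖ₑ ∂(hm n) + ε ∧
      volume {x | η x ≠ 1} ≤ ε := by
  set H : NNReal := (hm n K).toNNReal with hH
  have hHK : hm n K = H := (ENNReal.coe_toNNReal hKfin).symm
  set τ : NNReal := ε / (8 * (H + 1)) with hτdef
  have hτ : 0 < τ := by positivity
  have hτr : (0 : ℝ) < τ := hτ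
  set E : ℕ → Set (Eu n) := fun k => K ∩ (fun x => ⌊|φ x| / τ⌋₊) ⁻¹' {k} with hEdef
  have hEm : ∀ k, MeasurableSet (E k) := fun k =>
    hK.measurableSet.inter ((Nat.measurable_floor.comp
      (hφ.continuous.abs.measurable.div_const _)) (measurableSet_singleton k))
  have hEd : Pairwise (Function.onFun Disjoint E) := fun k l hkl =>
    disjoint_left.2 fun x hx hy => hkl (hx.2.symm.trans hy.2)
  have hEU : ⋃ k, E k = K := by
    ext x
    simp [hEdef]
  have hEfin : ∀ k, hm n (E k) ≠ ⊤ := fun k => measure_ne_top_of_subset inter_subset_left hKfin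
  have hfloor : ∀ k, ∀ x ∈ E k, k * (τ : ℝ) ≤ |φ x| ∧ |φ x| ≤ (k + 1) * τ := by
    rintro k x ⟨-, hx⟩
    have hx' : ⌊|φ x| / τ⌋₊ = k := hx
    rw [Nat.floor_eq_iff (by positivity), le_div_iff₀ hτr, div_lt_iff₀ hτr] at hx'
    exact ⟨hx'.1, hx'.2.le⟩
  obtain ⟨e, he0, hesum⟩ := ENNReal.exists_pos_sum_of_countable
    (ENNReal.coe_ne_zero.2 (half_pos hε).ne') ℕ
  choose ψ V h1 h2 h3 h4 h5 h6 h7 h8 using fun k =>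
    exists_bumps hn j hφ (hEfin k) (c := (k + 1) * τ) hτ
      (fun x hx => by simpa using (hfloor k x hx).2) (he0 k)
  have hlevel : ∀ k : ℕ, (k : ℝ≥0∞) * τ * hm n (E k) ≤ ∫⁻ x in E k, ‖φ x‖ₑ ∂(hm n) := fun k => by
    rw [← setLIntegral_const]
    refine setLIntegral_mono' (hEm k) fun x hx => ?_
    rw [← ofReal_norm, Real.norm_eq_abs, ← ENNReal.ofReal_coe_nnreal, ← ENNReal.ofReal_natCast,
      ← ENNReal.ofReal_mul (by positivity)]
    exact ENNReal.ofReal_le_ofReal (hfloor k x hx).1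
  have htot : ∑' p : ℕ × ℕ,
      ∫⁻ x, ‖φ x‖ₑ * ‖fderiv ℝ (ψ p.1 p.2) x (EuclideanSpace.single j 1)‖ₑ ≤
        2 * ∫⁻ x in K, ‖φ x‖ₑ ∂(hm n) + ε := by
    rw [ENNReal.tsum_prod (f := fun k i =>
      ∫⁻ x, ‖φ x‖ₑ * ‖fderiv ℝ (ψ k i) x (EuclideanSpace.single j 1)‖ₑ)]
    calc _ ≤ ∑' k, (2 * ∫⁻ x in E k, ‖φ x‖ₑ ∂(hm n) + (4 * τ * hm n (E k) + e k)) := by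
          refine ENNReal.tsum_le_tsum fun k => (h7 k).trans ?_
          rw [← add_assoc]
          gcongr
          calc 2 * ((((k + 1) * τ : NNReal) : ℝ≥0∞) + τ) * hm n (E k)
              = 2 * (k * τ * hm n (E k)) + 4 * τ * hm n (E k) := by push_cast; ring
            _ ≤ _ := by gcongr; exact hlevel k
      _ = 2 * ∫⁻ x in K, ‖φ x‖ₑ ∂(hm n) + (4 * τ * H + ∑' k, (e k : ℝ≥0∞)) := by
          rw [ENNReal.tsum_add, ENNReal.tsum_add, ENNReal.tsum_mul_left, ENNReal.tsum_mul_left,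
            ← lintegral_iUnion hEm hEd, ← measure_iUnion hEd hEm, hEU, hHK]
      _ ≤ 2 * ∫⁻ x in K, ‖φ x‖ₑ ∂(hm n) + (((ε / 2 : NNReal) : ℝ≥0∞) + (ε / 2 : NNReal)) := by
          gcongr
          norm_cast
          rw [hτdef, ← NNReal.coe_le_coe]
          push_cast
          rw [mul_div_assoc', div_mul_eq_mul_div, div_le_div_iff₀ (by positivity) (by positivity)]
          nlinarith [mul_nonneg ε.coe_nonneg H.coe_nonneg, ε.coe_nonneg]
      _ = _ := by rw [← ENNReal.coe_add, add_halves]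
  have hvol : ∑' p : ℕ × ℕ, volume (Function.support (ψ p.1 p.2)) ≤ ε := by
    rw [ENNReal.tsum_prod (f := fun k i => volume (Function.support (ψ k i)))]
    refine (ENNReal.tsum_le_tsum h8).trans (hesum.le.trans ?_)
    exact_mod_cast half_le_self hε.le
  obtain ⟨F, hF⟩ := hK.elim_finite_subcover (fun p : ℕ × ℕ => V p.1 p.2) (fun p => h4 p.1 p.2)
    (fun x hx => by
      rw [← hEU] at hx
      obtain ⟨k, hk⟩ := mem_iUnion.1 hx
      obtain ⟨i, hi⟩ := mem_iUnion.1 (h5 k hk)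
      exact mem_iUnion.2 ⟨(k, i), hi⟩)
  have hdiff : ∀ p : ℕ × ℕ, Differentiable ℝ (ψ p.1 p.2) := fun p =>
    (h1 p.1 p.2).differentiable (by simp)
  refine ⟨fun x => ∏ p ∈ F, (1 - ψ p.1 p.2 x),
    contDiff_prod fun p _ => contDiff_const.sub (h1 p.1 p.2),
    fun x => Finset.prod_nonneg fun p _ => sub_nonneg.2 (h3 _ _ x),
    fun x => Finset.prod_le_one (fun p _ => sub_nonneg.2 (h3 _ _ x))
      fun p _ => sub_le_self _ (h2 _ _ x),
    ⟨⋃ p ∈ F, V p.1 p.2, isOpen_biUnion fun p _ => h4 p.1 p.2, hF, fun x hx => ?_⟩, ?_, ?_⟩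
  · obtain ⟨p, hp, hx⟩ := mem_iUnion₂.1 hx
    exact Finset.prod_eq_zero hp (by rw [h6 _ _ x hx, sub_self])
  · have hle : ∀ x, ‖fderiv ℝ (fun x => ∏ p ∈ F, (1 - ψ p.1 p.2 x)) x
        (EuclideanSpace.single j 1)‖ₑ ≤
        ∑ p ∈ F, ‖fderiv ℝ (ψ p.1 p.2) x (EuclideanSpace.single j 1)‖ₑ := fun x => by
      have hder : ∀ p ∈ F, HasFDerivAt (fun x => 1 - ψ p.1 p.2 x) (-fderiv ℝ (ψ p.1 p.2) x) x :=
        fun p _ => (hdiff p x).hasFDerivAt.const_sub 1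
      rw [(HasFDerivAt.finsetProd hder).fderiv, _root_.sum_apply]
      refine (enorm_sum_le _ _).trans (Finset.sum_le_sum fun p hp => ?_)
      rw [_root_.smul_apply, enorm_smul, _root_.neg_apply, enorm_neg]
      refine mul_le_of_le_one_left' ?_
      rw [← ofReal_norm, Real.norm_eq_abs, abs_of_nonneg
        (Finset.prod_nonneg fun p _ => sub_nonneg.2 (h3 _ _ x)), ENNReal.ofReal_le_one]
      exact Finset.prod_le_one (fun p _ => sub_nonneg.2 (h3 _ _ x))
        fun p _ => sub_le_self _ (h2 _ _ x)
    have hmeas : ∀ p : ℕ × ℕ, Measurable fun x =>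
        ‖φ x‖ₑ * ‖fderiv ℝ (ψ p.1 p.2) x (EuclideanSpace.single j 1)‖ₑ := fun p =>
      hφ.continuous.measurable.enorm.mul
        ((((h1 p.1 p.2).continuous_fderiv (by simp)).clm_apply continuous_const).measurable.enorm)
    calc _ ≤ ∫⁻ x, ∑ p ∈ F, ‖φ x‖ₑ * ‖fderiv ℝ (ψ p.1 p.2) x (EuclideanSpace.single j 1)‖ₑ := by
          refine lintegral_mono fun x => ?_
          rw [← Finset.mul_sum]
          exact mul_le_mul_right (hle x) _
      _ = ∑ p ∈ F, ∫⁻ x, ‖φ x‖ₑ * ‖fderiv ℝ (ψ p.1 p.2) x (EuclideanSpace.single j 1)‖ₑ :=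
          lintegral_finsetSum _ fun p _ => hmeas p
      _ ≤ _ := (ENNReal.sum_le_tsum F).trans htot
  · calc _ ≤ volume (⋃ p ∈ F, Function.support (ψ p.1 p.2)) := by
          refine measure_mono fun x hx => ?_
          by_contra h
          simp only [mem_iUnion, Function.mem_support, not_exists, not_not] at h
          exact hx (Finset.prod_eq_one fun p hp => by rw [h p hp, sub_zero])
      _ ≤ ∑ p ∈ F, volume (Function.support (ψ p.1 p.2)) := measure_biUnion_finset_le _ _
      _ ≤ _ := (ENNReal.sum_le_tsum F).trans hvol

theorem gradient_apply_eq_fderiv {n : ℕ} (φ : Eu n → ℝ) (x : Eu n) (j : Fin n) :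
    gradient φ x j = fderiv ℝ φ x (EuclideanSpace.single j 1) := by
  rw [gradient, ← InnerProductSpace.toDual_symm_apply, EuclideanSpace.inner_single_right]
  simp

theorem continuous_gradient {n : ℕ} {φ : Eu n → ℝ} (hφ : ContDiff ℝ (⊤ : ℕ∞) φ) :
    Continuous (gradient φ) :=
  (InnerProductSpace.toDual ℝ (Eu n)).symm.continuous.comp (hφ.continuous_fderiv (by simp))

theorem integrable_gradient {n : ℕ} {φ : Eu n → ℝ} (hφ : ContDiff ℝ (⊤ : ℕ∞) φ)
    (hs : HasCompactSupport φ) : Integrable (gradient φ) := by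
  refine (continuous_gradient hφ).integrable_of_hasCompactSupport ?_
  exact (hs.fderiv (𝕜 := ℝ)).comp_left (g := (InnerProductSpace.toDual ℝ (Eu n)).symm) (map_zero _)

theorem integrableOn_smul_gradient {n : ℕ} {Ω : Set (Eu n)} {u : Eu n → ℝ} {C : ℝ}
    (hub : BddFun Ω u C) {φ : Eu n → ℝ} (hφ : ContDiff ℝ (⊤ : ℕ∞) φ) (hs : HasCompactSupport φ) :
    IntegrableOn (fun x => u x • gradient φ x) Ω :=
  (integrable_gradient hφ hs).integrableOn.bdd_smul C hub.1 hub.2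

/-- Coordinates of `∫ u ∇φ`. -/
theorem setIntegral_smul_gradient_apply {n : ℕ} {Ω : Set (Eu n)} {u : Eu n → ℝ} {C : ℝ}
    (hub : BddFun Ω u C) {φ : Eu n → ℝ} (hφ : ContDiff ℝ (⊤ : ℕ∞) φ) (hs : HasCompactSupport φ)
    (j : Fin n) : (∫ x in Ω, u x • gradient φ x) j =
      ∫ x in Ω, u x * fderiv ℝ φ x (EuclideanSpace.single j 1) := by
  have h := (EuclideanSpace.proj j : Eu n →L[ℝ] ℝ).integral_comp_comm
    (integrableOn_smul_gradient hub hφ hs)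
  simp only [EuclideanSpace.coe_proj, PiLp.smul_apply, smul_eq_mul, gradient_apply_eq_fderiv] at h
  exact h.symm

/-- The distributional derivative is controlled by the variation measure. -/
theorem abs_setIntegral_le_of_isTest {n : ℕ} {Ω : Set (Eu n)} {u : Eu n → ℝ} {C : ℝ}
    (hub : BddFun Ω u C) {ν : Measure (Eu n)} {θ : Eu n → Eu n} [IsFiniteMeasure ν]
    (hgrad : HasGradMeasure Ω u ν θ) {ψ : Eu n → ℝ} (hψ : IsTest Ω ψ) (j : Fin n) :
    |∫ x in Ω, u x * fderiv ℝ ψ x (EuclideanSpace.single j 1)| ≤ ∫ x, |ψ x| ∂ν := by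
  rw [← setIntegral_smul_gradient_apply hub hψ.1 hψ.2.1 j, hgrad.2.2 ψ hψ, ← Real.norm_eq_abs]
  refine (PiLp.norm_apply_le _ j).trans ?_
  rw [norm_neg]
  refine norm_integral_le_of_norm_le
    (hψ.1.continuous.integrable_of_hasCompactSupport hψ.2.1).abs ?_
  filter_upwards [hgrad.1] with x hx
  rw [norm_smul, hx, mul_one, Real.norm_eq_abs]

/-- Cutting off a smooth function which vanishes near the boundary. -/
theorem isTest_indicator {n : ℕ} {Ω : Set (Eu n)} (hΩ : IsOpen Ω) {f : Eu n → ℝ}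
    (hf : ContDiff ℝ (⊤ : ℕ∞) f) (hs : HasCompactSupport f)
    (hd : Disjoint (tsupport f) (frontier Ω)) : IsTest Ω (Ω.indicator f) := by
  have hts : tsupport (Ω.indicator f) ⊆ Ω := by
    have h1 : tsupport (Ω.indicator f) ⊆ closure Ω ∩ tsupport f := by
      refine closure_minimal (fun x hx => ?_) (isClosed_closure.inter (isClosed_tsupport f))
      rw [Function.mem_support] at hx
      have hxΩ : x ∈ Ω := by
        by_contra h
        exact hx (indicator_of_notMem h f)
      rw [indicator_of_mem hxΩ] at hx
      exact ⟨subset_closure hxΩ, subset_tsupport f hx⟩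
    intro x hx
    by_contra h
    refine disjoint_left.1 hd (h1 hx).2 ?_
    rw [hΩ.frontier_eq]
    exact ⟨(h1 hx).1, h⟩
  refine ⟨contDiff_iff_contDiffAt.2 fun x => ?_, ?_, hts⟩
  · by_cases hx : x ∈ Ω
    · exact hf.contDiffAt.congr_of_eventuallyEq
        (eqOn_indicator.eventuallyEq_of_mem (hΩ.mem_nhds hx))
    · have h0 : Ω.indicator f =ᶠ[𝓝 x] 0 := notMem_tsupport_iff_eventuallyEq.1 fun h => hx (hts h)
      exact contDiffAt_const.congr_of_eventuallyEq h0
  · exact hs.mono (by rw [support_indicator]; exact inter_subset_right)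

/-- The distributional derivative of the zero extension of a bounded `BV` function. -/
theorem abs_setIntegral_le_of_cutoff {n : ℕ} (hn : 1 ≤ n) {Ω : Set (Eu n)} (hΩ : IsOpen Ω)
    (hfr : hm n (frontier Ω) < ⊤) {u : Eu n → ℝ} {C : ℝ} (hC : 0 ≤ C) (hub : BddFun Ω u C)
    {ν : Measure (Eu n)} {θ : Eu n → Eu n} [IsFiniteMeasure ν] (hgrad : HasGradMeasure Ω u ν θ)
    {φ : Eu n → ℝ} (hφ : IsTest univ φ) (j : Fin n) :
    |∫ x in Ω, u x * fderiv ℝ φ x (EuclideanSpace.single j 1)| ≤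
      ∫ x, |φ x| ∂ν + 2 * C * ∫ x in frontier Ω, |φ x| ∂(hm n) := by
  have hfin : IsFiniteMeasure ((hm n).restrict (frontier Ω)) :=
    ⟨by rwa [Measure.restrict_apply_univ]⟩
  obtain ⟨hφc, hφs, -⟩ := hφ
  set D : (Eu n → ℝ) → Eu n → ℝ := fun f x => fderiv ℝ f x (EuclideanSpace.single j 1) with hD
  have hDc : ∀ f, ContDiff ℝ (⊤ : ℕ∞) f → Continuous (D f) := fun f hf =>
    (hf.continuous_fderiv (by simp)).clm_apply continuous_const
  have hDs : ∀ f, HasCompactSupport f → HasCompactSupport (D f) := fun f hf =>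
    (hf.fderiv (𝕜 := ℝ)).comp_left (g := fun l : Eu n →L[ℝ] ℝ => l (EuclideanSpace.single j 1)) rfl
  obtain ⟨M, hM⟩ := (hDc φ hφc).bounded_above_of_compact_support (hDs φ hφs)
  have hM0 : 0 ≤ M := (norm_nonneg _).trans (hM 0)
  have hBint : Integrable (fun x => |φ x|) ((hm n).restrict (frontier Ω)) :=
    (hφc.continuous.integrable_of_hasCompactSupport hφs).abs
  set B := ∫ x in frontier Ω, |φ x| ∂(hm n) with hB
  have hB0 : 0 ≤ B := integral_nonneg fun x => abs_nonneg _
  have hBl : ∫⁻ x in frontier Ω, ‖φ x‖ₑ ∂(hm n) = ENNReal.ofReal B := by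
    rw [hB, ofReal_integral_eq_lintegral_ofReal hBint (ae_of_all _ fun x => abs_nonneg _)]
    simp only [← ofReal_norm, Real.norm_eq_abs]
  have key : ∀ ε : NNReal, 0 < ε → |∫ x in Ω, u x * D φ x| ≤
      ∫ x, |φ x| ∂ν + 2 * C * B + ε * (C + C * M) := by
    intro ε hε
    have hKc : IsCompact (tsupport φ ∩ frontier Ω) := hφs.inter_right isClosed_frontier
    obtain ⟨η, hηc, hη0, hη1, ⟨V, hV, hKV, hηV⟩, hηd, hηv⟩ := exists_cutoff hn j
      (hφs.uniformContinuous_of_continuous hφc.continuous) hKc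
      (measure_ne_top_of_subset inter_subset_right hfr.ne) hε
    have hηφ : ContDiff ℝ (⊤ : ℕ∞) (fun x => η x * φ x) := hηc.mul hφc
    have hηφs : HasCompactSupport (fun x => η x * φ x) := hφs.mul_left
    have hdisj : Disjoint (tsupport fun x => η x * φ x) (frontier Ω) := by
      refine disjoint_left.2 fun x hx hxf => ?_
      have hxφ : x ∈ tsupport φ := closure_mono (Function.support_mul_subset_right η φ) hx
      refine notMem_tsupport_iff_eventuallyEq.2 ?_ hx
      filter_upwards [hV.mem_nhds (hKV ⟨hxφ, hxf⟩)] with y hy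
      simp [hηV y hy]
    have htest := isTest_indicator hΩ hηφ hηφs hdisj
    have hprod : ∀ x, D (fun x => η x * φ x) x = η x * D φ x + φ x * D η x := fun x => by
      have h := ((hηc.differentiable (by simp) x).hasFDerivAt.fun_mul
        (hφc.differentiable (by simp) x).hasFDerivAt).fderiv
      simp [hD, h]
    have h1 : |∫ x in Ω, u x * D (fun x => η x * φ x) x| ≤ ∫ x, |φ x| ∂ν := by
      have h2 := abs_setIntegral_le_of_isTest hub hgrad htest j
      have h3 : ∫ x in Ω, u x * D (fun x => η x * φ x) x =
          ∫ x in Ω, u x * D (Ω.indicator fun x => η x * φ x) x := by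
        refine setIntegral_congr_fun hΩ.measurableSet fun x hx => ?_
        have h4 : Ω.indicator (fun x => η x * φ x) =ᶠ[𝓝 x] fun x => η x * φ x :=
          eqOn_indicator.eventuallyEq_of_mem (hΩ.mem_nhds hx)
        simp only [hD, h4.fderiv_eq]
      rw [h3]
      refine h2.trans (integral_mono (htest.1.continuous.integrable_of_hasCompactSupport
        htest.2.1).abs (hφc.continuous.integrable_of_hasCompactSupport hφs).abs fun x => ?_)
      by_cases hx : x ∈ Ω
      · simp only [indicator_of_mem hx, abs_mul, abs_of_nonneg (hη0 x)]
        exact mul_le_of_le_one_left (abs_nonneg _) (hη1 x)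
      · simp [indicator_of_notMem hx]
    have hbd : ∀ g : Eu n → ℝ, Integrable g → IntegrableOn (fun x => u x * g x) Ω := fun g hg =>
      hg.integrableOn.bdd_mul hub.1 hub.2
    have hbdle : ∀ g : Eu n → ℝ, Integrable g → |∫ x in Ω, u x * g x| ≤ C * ∫ x, |g x| :=
      fun g hg => by
        rw [← integral_const_mul, ← Real.norm_eq_abs]
        refine (norm_integral_le_of_norm_le (hg.abs.const_mul C).integrableOn ?_).trans
          (setIntegral_le_integral (hg.abs.const_mul C) (ae_of_all _ fun x => by positivity))
        filter_upwards [hub.2] with x hx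
        rw [norm_mul, Real.norm_eq_abs, Real.norm_eq_abs]
        gcongr
    have hg1c : Continuous fun x => (1 - η x) * D φ x :=
      (continuous_const.sub hηc.continuous).mul (hDc φ hφc)
    have hg1 : Integrable fun x => (1 - η x) * D φ x :=
      hg1c.integrable_of_hasCompactSupport (hDs φ hφs).mul_left
    have hg2 : Integrable fun x => φ x * D η x :=
      (hφc.continuous.mul (hDc η hηc)).integrable_of_hasCompactSupport hφs.mul_right
    have hg3 : Integrable (D fun x => η x * φ x) :=
      (hDc _ hηφ).integrable_of_hasCompactSupport (hDs _ hηφs)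
    have hsplit : ∫ x in Ω, u x * D φ x = (∫ x in Ω, u x * ((1 - η x) * D φ x)) +
        (∫ x in Ω, u x * D (fun x => η x * φ x) x) - ∫ x in Ω, u x * (φ x * D η x) := by
      rw [← integral_add (hbd _ hg1) (hbd _ hg3),
        ← integral_sub ((hbd _ hg1).fun_add (hbd _ hg3)) (hbd _ hg2)]
      refine integral_congr_ae (ae_of_all _ fun x => ?_)
      simp only [hprod]
      ring
    have hI1 : ∫ x, |(1 - η x) * D φ x| ≤ M * ε := by
      have hmeas : MeasurableSet {x | η x ≠ 1} :=
        (measurableSet_eq_fun hηc.continuous.measurable measurable_const).compl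
      have hvfin : volume {x | η x ≠ 1} ≠ ⊤ := ne_top_of_le_ne_top ENNReal.coe_ne_top hηv
      calc ∫ x, |(1 - η x) * D φ x| ≤ ∫ x, {x | η x ≠ 1}.indicator (fun _ => M) x := by
            refine integral_mono hg1.abs ((integrable_indicator_iff hmeas).2
              (integrableOn_const hvfin)) fun x => ?_
            by_cases hx : η x = 1
            · simp [hx]
            · rw [indicator_of_mem (show x ∈ {x | η x ≠ 1} from hx), abs_mul,
                abs_of_nonneg (sub_nonneg.2 (hη1 x))]
              exact (mul_le_of_le_one_left (abs_nonneg _) (sub_le_self _ (hη0 x))).trans (hM x)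
        _ = M * volume.real {x | η x ≠ 1} := by
            rw [integral_indicator_const _ hmeas, smul_eq_mul, mul_comm]
        _ ≤ M * ε := by
            gcongr
            exact ENNReal.toReal_le_of_le_ofReal ε.coe_nonneg
              (by rwa [ENNReal.ofReal_coe_nnreal])
    have hI2 : ∫ x, |φ x * D η x| ≤ 2 * B + ε := by
      have h5 : ∫⁻ x, ENNReal.ofReal |φ x * D η x| ≤ ENNReal.ofReal (2 * B + ε) := by
        calc _ = ∫⁻ x, ‖φ x‖ₑ * ‖D η x‖ₑ := by
              refine lintegral_congr fun x => ?_
              rw [← Real.norm_eq_abs, ofReal_norm, enorm_mul]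
          _ ≤ _ := hηd
          _ ≤ 2 * ENNReal.ofReal B + ε := by
              rw [← hBl]
              gcongr
              exact inter_subset_right
          _ = _ := by
              rw [ENNReal.ofReal_add (by positivity) ε.coe_nonneg, ENNReal.ofReal_mul zero_le_two,
                ENNReal.ofReal_coe_nnreal, ENNReal.ofReal_ofNat]
      rw [integral_eq_lintegral_of_nonneg_ae (ae_of_all _ fun x => abs_nonneg _)
        hg2.abs.aestronglyMeasurable]
      exact ENNReal.toReal_le_of_le_ofReal (by positivity) h5
    rw [hsplit]
    have h6 := (hbdle _ hg1).trans (mul_le_mul_of_nonneg_left hI1 hC)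
    have h7 := (hbdle _ hg2).trans (mul_le_mul_of_nonneg_left hI2 hC)
    refine (abs_sub _ _).trans ((add_le_add (abs_add_le _ _) le_rfl).trans ?_)
    linarith
  refine le_of_forall_pos_le_add fun ε hε => ?_
  have hden : 0 < C + C * M + 1 := by positivity
  have hpos : 0 < ε / (C + C * M + 1) := div_pos hε hden
  refine (key (Real.toNNReal (ε / (C + C * M + 1))) (Real.toNNReal_pos.2 hpos)).trans
    (add_le_add le_rfl ?_)
  rw [Real.coe_toNNReal _ hpos.le, div_mul_eq_mul_div, div_le_iff₀ hden]
  nlinarith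

/-- A linear functional dominated by the `L¹` norm of a finite measure is given by a density
bounded by one. -/
theorem exists_density_of_abs_le_integral {α : Type*} [MeasurableSpace α] (μ : Measure α)
    [IsFiniteMeasure μ] (T : Submodule ℝ (α → ℝ)) (hT : ∀ f ∈ T, MemLp f 2 μ) (L : T →ₗ[ℝ] ℝ)
    (hL : ∀ f : T, |L f| ≤ ∫ x, |(f : α → ℝ) x| ∂μ) :
    ∃ g : α → ℝ, Measurable g ∧ (∀ᵐ x ∂μ, |g x| ≤ 1) ∧
      ∀ f : T, L f = ∫ x, (f : α → ℝ) x * g x ∂μ := by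
  have hT1 : ∀ f ∈ T, MemLp f 1 μ := fun f hf => (hT f hf).mono_exponent (by norm_num)
  let ι : T →ₗ[ℝ] Lp ℝ 1 μ :=
    { toFun := fun f => (hT1 f f.2).toLp f
      map_add' := fun f g => MemLp.toLp_add _ _
      map_smul' := fun c f => MemLp.toLp_const_smul c _ }
  have hι : ∀ f : T, ‖ι f‖ = ∫ x, |(f : α → ℝ) x| ∂μ := fun f => by
    rw [L1.norm_eq_integral_norm]
    refine integral_congr_ae ?_
    filter_upwards [(hT1 f f.2).coeFn_toLp] with x hx
    rw [← Real.norm_eq_abs, ← hx]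
    rfl
  have hker : LinearMap.ker ι ≤ LinearMap.ker L := fun f hf => by
    rw [LinearMap.mem_ker] at hf ⊢
    refine abs_eq_zero.1 (le_antisymm ((hL f).trans (le_of_eq ?_)) (abs_nonneg _))
    rw [← hι, hf, norm_zero]
  let f₀ : LinearMap.range ι →ₗ[ℝ] ℝ :=
    ((LinearMap.ker ι).liftQ L hker).comp ι.quotKerEquivRange.symm.toLinearMap
  have hf₀ : ∀ f : T, ∀ h, f₀ ⟨ι f, h⟩ = L f := fun f h => by
    simp only [f₀, LinearMap.comp_apply, LinearEquiv.coe_coe,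
      LinearMap.quotKerEquivRange_symm_apply_image, Submodule.mkQ_apply, Submodule.liftQ_apply]
  have hb₀ : ∀ y, ‖f₀ y‖ ≤ 1 * ‖y‖ := by
    rintro ⟨y, hy⟩
    obtain ⟨f, rfl⟩ := LinearMap.mem_range.1 hy
    rw [hf₀, one_mul, Real.norm_eq_abs, Submodule.coe_norm, hι]
    exact hL f
  obtain ⟨F, hF, hFn⟩ := exists_extension_norm_eq _ (f₀.mkContinuous 1 hb₀)
  have hF1 : ‖F‖ ≤ 1 := hFn ▸ f₀.mkContinuous_norm_le zero_le_one hb₀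
  let J : Lp ℝ 2 μ →L[ℝ] Lp ℝ 1 μ :=
    (ContinuousLinearMap.mul ℝ ℝ).holderL μ 2 2 1 (Lp.const 2 μ (1 : ℝ))
  have hJ : ∀ f : Lp ℝ 2 μ, J f =ᵐ[μ] f := fun f => by
    filter_upwards [(ContinuousLinearMap.mul ℝ ℝ).coeFn_holder (r := 1) (Lp.const 2 μ (1 : ℝ)) f,
      Lp.coeFn_const 2 μ (1 : ℝ)] with x h1 h2
    rw [show J f = (ContinuousLinearMap.mul ℝ ℝ).holder 1 (Lp.const 2 μ (1 : ℝ)) f from rfl, h1, h2]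
    simp
  let G : Lp ℝ 2 μ := (InnerProductSpace.toDual ℝ (Lp ℝ 2 μ)).symm (F.comp J)
  have hG : ∀ f : Lp ℝ 2 μ, F (J f) = ∫ x, f x * G x ∂μ := fun f => by
    rw [← ContinuousLinearMap.comp_apply, ← InnerProductSpace.toDual_symm_apply, L2.inner_def]
    rfl
  have hGint : Integrable G μ := (Lp.memLp G).integrable (by norm_num)
  have hset : ∀ s, MeasurableSet s → |∫ x in s, G x ∂μ| ≤ μ.real s := fun s hs => by
    have h1 := hG (indicatorConstLp 2 hs (measure_ne_top μ s) (1 : ℝ))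
    have h2 : ∫ x, indicatorConstLp 2 hs (measure_ne_top μ s) (1 : ℝ) x * G x ∂μ =
        ∫ x in s, G x ∂μ := by
      rw [← integral_indicator hs]
      refine integral_congr_ae ?_
      filter_upwards [indicatorConstLp_coeFn (p := 2) (hs := hs) (hμs := measure_ne_top μ s)
        (c := (1 : ℝ))] with x hx
      rw [hx]
      by_cases hxs : x ∈ s <;> simp [hxs]
    rw [← h2, ← h1]
    refine (F.le_opNorm _).trans ((mul_le_mul_of_nonneg_right hF1 (norm_nonneg _)).trans ?_)
    rw [one_mul, L1.norm_eq_integral_norm]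
    refine le_of_eq ?_
    rw [← integral_indicator_one hs]
    refine integral_congr_ae ?_
    filter_upwards [hJ (indicatorConstLp 2 hs (measure_ne_top μ s) (1 : ℝ)),
      indicatorConstLp_coeFn (p := 2) (hs := hs) (hμs := measure_ne_top μ s) (c := (1 : ℝ))]
      with x h3 h4
    rw [h3, h4]
    by_cases hxs : x ∈ s <;> simp [hxs]
  have hle : ∀ᵐ x ∂μ, G x ≤ 1 := by
    refine ae_le_of_forall_setIntegral_le hGint (integrable_const 1) fun s hs _ => ?_
    rw [setIntegral_const, smul_eq_mul, mul_one]
    exact (le_abs_self _).trans (hset s hs)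
  have hge : ∀ᵐ x ∂μ, -1 ≤ G x := by
    refine ae_le_of_forall_setIntegral_le (integrable_const (-1)) hGint fun s hs _ => ?_
    rw [setIntegral_const, smul_eq_mul, mul_neg_one]
    exact neg_le_of_abs_le (hset s hs)
  refine ⟨G, (Lp.stronglyMeasurable G).measurable, ?_, fun f => ?_⟩
  · filter_upwards [hle, hge] with x h1 h2 using abs_le.2 ⟨h2, h1⟩
  · have h1 := hG ((hT f f.2).toLp f)
    have h2 : J ((hT f f.2).toLp f) = ι f := by
      refine Lp.ext ((hJ _).trans ((hT f f.2).coeFn_toLp.trans (hT1 f f.2).coeFn_toLp.symm))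
    rw [h2] at h1
    have h3 : F (ι f) = L f := (hF ⟨ι f, ⟨f, rfl⟩⟩).trans (hf₀ f _)
    rw [← h3, h1]
    refine integral_congr_ae ?_
    filter_upwards [(hT f f.2).coeFn_toLp] with x hx
    rw [hx]

/-- The space of test functions on the whole space. -/
def testSubmodule (n : ℕ) : Submodule ℝ (Eu n → ℝ) where
  carrier := {φ | IsTest univ φ}
  add_mem' := fun h₁ h₂ => ⟨h₁.1.add h₂.1, h₁.2.1.add h₂.2.1, subset_univ _⟩
  zero_mem' := ⟨contDiff_const, HasCompactSupport.zero, subset_univ _⟩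
  smul_mem' := fun c _ h => ⟨contDiff_const.smul h.1, h.2.1.smul_left (f := fun _ => c),
    subset_univ _⟩

theorem norm_toLp_le_sqrt_of_abs_le_one {n : ℕ} {v : Fin n → ℝ} (hv : ∀ j, |v j| ≤ 1) :
    ‖(WithLp.toLp 2 v : Eu n)‖ ≤ √n := by
  rw [EuclideanSpace.norm_eq]
  refine Real.sqrt_le_sqrt ?_
  calc ∑ j, ‖v j‖ ^ 2 ≤ ∑ _j : Fin n, (1 : ℝ) :=
        Finset.sum_le_sum fun j _ => pow_le_one₀ (norm_nonneg _) (hv j)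
    _ = n := by simp

/-- A vector-valued density with respect to a finite measure can be put in polar form. -/
theorem hasGradMeasure_withDensity {n : ℕ} {u : Eu n → ℝ} {μ : Measure (Eu n)}
    {g : Eu n → Eu n} (hg : Measurable g)
    (h : ∀ φ, IsTest univ φ → ∫ x, u x • gradient φ x = ∫ x, φ x • g x ∂μ) :
    HasGradMeasure univ u (μ.withDensity fun x => ‖g x‖ₑ) (fun x => -(‖g x‖⁻¹ • g x)) := by
  refine ⟨?_, by simp, fun φ hφ => ?_⟩
  · rw [ae_withDensity_iff hg.enorm]
    refine Eventually.of_forall fun x hx => ?_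
    have h0 : ‖g x‖ ≠ 0 := by simpa using hx
    rw [norm_neg, norm_smul, norm_inv, norm_norm, inv_mul_cancel₀ h0]
  · rw [setIntegral_univ, h φ hφ, ← integral_neg]
    have := integral_withDensity_eq_integral_smul hg.nnnorm (μ := μ)
      (fun x => -(φ x • -(‖g x‖⁻¹ • g x)))
    simp only [enorm_eq_nnnorm]
    rw [this]
    refine integral_congr_ae (Eventually.of_forall fun x => ?_)
    by_cases h0 : ‖g x‖ = 0
    · simp [norm_eq_zero.1 h0]
    · simp only [smul_neg, neg_neg, NNReal.smul_def, coe_nnnorm]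
      rw [smul_comm, smul_smul ‖g x‖, mul_inv_cancel₀ h0, one_smul]

/-- A bounded function with finite gradient measure on `Ω` extends by zero to a function with
finite gradient measure on the whole space. -/
theorem exists_hasGradMeasure_indicator {n : ℕ} (hn : 1 ≤ n) {Ω : Set (Eu n)} (hΩ : IsOpen Ω)
    (hfr : hm n (frontier Ω) < ⊤) {u : Eu n → ℝ} {C : ℝ} (hC : 0 ≤ C) (hub : BddFun Ω u C)
    {ν : Measure (Eu n)} [IsFiniteMeasure ν] {θ : Eu n → Eu n} (hgrad : HasGradMeasure Ω u ν θ) :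
    ∃ ν' θ', ν' univ < ⊤ ∧ HasGradMeasure univ (Ω.indicator u) ν' θ' ∧
      ν' (frontier Ω) ≤ ENNReal.ofReal (2 * √n) * ENNReal.ofReal C * hm n (frontier Ω) := by
  have : IsFiniteMeasure ((hm n).restrict (frontier Ω)) := ⟨by simpa using hfr⟩
  set μ : Measure (Eu n) := ν + (2 * C).toNNReal • (hm n).restrict (frontier Ω) with hμ
  have hCont : ∀ φ ∈ testSubmodule n, Continuous φ ∧ HasCompactSupport φ :=
    fun φ hφ => ⟨hφ.1.continuous, hφ.2.1⟩
  have hInt : ∀ φ ∈ testSubmodule n, ∀ j,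
      IntegrableOn (fun x => u x * fderiv ℝ φ x (EuclideanSpace.single j 1)) Ω := by
    intro φ hφ j
    have h := ((EuclideanSpace.proj j : Eu n →L[ℝ] ℝ).integrable_comp
      (integrableOn_smul_gradient hub (hφ.1.of_le (by simp)) hφ.2.1))
    refine h.congr (Eventually.of_forall fun x => ?_)
    simp [gradient_apply_eq_fderiv]
  have hdiff : ∀ φ ∈ testSubmodule n, Differentiable ℝ φ :=
    fun φ hφ => hφ.1.differentiable (by simp)
  have key : ∀ j : Fin n, ∃ g : Eu n → ℝ, Measurable g ∧ (∀ᵐ x ∂μ, |g x| ≤ 1) ∧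
      ∀ φ : Eu n → ℝ, IsTest univ φ →
        ∫ x in Ω, u x * fderiv ℝ φ x (EuclideanSpace.single j 1) = ∫ x, φ x * g x ∂μ := by
    intro j
    let L : testSubmodule n →ₗ[ℝ] ℝ :=
      { toFun := fun φ => ∫ x in Ω, u x * fderiv ℝ (φ : Eu n → ℝ) x (EuclideanSpace.single j 1)
        map_add' := fun φ ψ => by
          rw [← integral_add (hInt φ φ.2 j) (hInt ψ ψ.2 j)]
          refine integral_congr_ae (Eventually.of_forall fun x => ?_)
          simp only [Submodule.coe_add]
          rw [fderiv_add (hdiff φ φ.2 x) (hdiff ψ ψ.2 x), add_apply, mul_add]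
        map_smul' := fun c φ => by
          rw [RingHom.id_apply, smul_eq_mul, ← integral_const_mul]
          refine integral_congr_ae (Eventually.of_forall fun x => ?_)
          simp only [Submodule.coe_smul]
          rw [fderiv_const_smul (hdiff φ φ.2 x), smul_apply, smul_eq_mul]
          ring }
    obtain ⟨g, hg, hg1, hgL⟩ := exists_density_of_abs_le_integral μ (testSubmodule n)
      (fun φ hφ => (hCont φ hφ).1.memLp_of_hasCompactSupport (hCont φ hφ).2) L fun φ => by
        refine (abs_setIntegral_le_of_cutoff hn hΩ hfr hC hub hgrad φ.2 j).trans (le_of_eq ?_)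
        have hi : ∀ (ρ : Measure (Eu n)) [IsFiniteMeasure ρ],
            Integrable (fun x => |(φ : Eu n → ℝ) x|) ρ := fun ρ _ =>
          ((hCont φ φ.2).1.integrable_of_hasCompactSupport (hCont φ φ.2).2).abs
        rw [hμ, integral_add_measure (hi _) (hi _), integral_smul_nnreal_measure, NNReal.smul_def,
          Real.coe_toNNReal _ (by positivity), smul_eq_mul]
    exact ⟨g, hg, hg1, fun φ hφ => hgL ⟨φ, hφ⟩⟩
  choose g hg hg1 hgφ using key
  have hG : Measurable fun x => (WithLp.toLp 2 fun j => g j x : Eu n) :=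
    (WithLp.measurable_toLp 2 _).comp (measurable_pi_lambda _ hg)
  have hGle : ∀ᵐ x ∂μ, ‖(WithLp.toLp 2 fun j => g j x : Eu n)‖ₑ ≤ ENNReal.ofReal √n := by
    filter_upwards [ae_all_iff.2 hg1] with x hx
    rw [← ofReal_norm]
    exact ENNReal.ofReal_le_ofReal (norm_toLp_le_sqrt_of_abs_le_one hx)
  have hbound : ∀ s, MeasurableSet s →
      μ.withDensity (fun x => ‖(WithLp.toLp 2 fun j => g j x : Eu n)‖ₑ) s ≤
        ENNReal.ofReal √n * μ s := fun s hs => by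
    rw [withDensity_apply _ hs, ← setLIntegral_const]
    exact lintegral_mono_ae (ae_restrict_of_ae hGle)
  refine ⟨_, _, (hbound univ .univ).trans_lt
    (ENNReal.mul_lt_top ENNReal.ofReal_lt_top (measure_lt_top _ _)),
    hasGradMeasure_withDensity hG fun φ hφ => ?_, ?_⟩
  · have h1 : ∫ x, Ω.indicator u x • gradient φ x = ∫ x in Ω, u x • gradient φ x := by
      rw [← integral_indicator hΩ.measurableSet]
      simp only [indicator_smul_left]
    have hφG : Integrable (fun x => φ x • (WithLp.toLp 2 fun j => g j x : Eu n)) μ := by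
      refine Integrable.smul_of_top_left
        ((hCont φ hφ).1.integrable_of_hasCompactSupport (hCont φ hφ).2) ?_
      refine memLp_top_of_bound hG.aestronglyMeasurable (√n) ?_
      filter_upwards [ae_all_iff.2 hg1] with x hx using norm_toLp_le_sqrt_of_abs_le_one hx
    ext j
    rw [h1, setIntegral_smul_gradient_apply hub (hφ.1.of_le (by simp)) hφ.2.1, hgφ j φ hφ]
    exact (EuclideanSpace.proj j : Eu n →L[ℝ] ℝ).integral_comp_comm hφG
  · refine (hbound _ isClosed_frontier.measurableSet).trans (le_of_eq ?_)
    have h0 : ν (frontier Ω) = 0 :=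
      measure_mono_null (fun x hx => (hΩ.frontier_eq ▸ hx).2) hgrad.2.1
    rw [hμ, Measure.add_apply, h0, zero_add, Measure.smul_apply, Measure.restrict_apply_self,
      ENNReal.smul_def, smul_eq_mul, ← mul_assoc, ← ENNReal.ofReal, ENNReal.ofReal_mul zero_le_two,
      ENNReal.ofReal_mul zero_le_two]
    ring

/-- The function `x ↦ √π Γ(x + 1/2) / Γ(x)` dominates `√(2x)` at positive half-integers. -/
theorem sqrt_mul_Gamma_le (k : ℕ) :
    √(k + 1 : ℕ) * Real.Gamma ((k + 1 : ℕ) / 2) ≤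
      √Real.pi * Real.Gamma (((k + 1 : ℕ) + 1) / 2) := by
  induction k using Nat.twoStepInduction with
  | zero =>
    have h := Real.Gamma_one_half_eq
    norm_num at h ⊢
    exact h.le
  | one =>
    have h : Real.Gamma (3 / 2) = √Real.pi / 2 := by
      rw [show (3 / 2 : ℝ) = 1 / 2 + 1 by norm_num, Real.Gamma_add_one (by norm_num),
        Real.Gamma_one_half_eq]
      ring
    norm_num [h]
    rw [← mul_div_assoc, Real.mul_self_sqrt Real.pi_pos.le, le_div_iff₀ two_pos]
    nlinarith [Real.pi_gt_three, Real.sq_sqrt (zero_le_two (α := ℝ)), Real.sqrt_nonneg 2,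
      sq_nonneg (√2 - 1.5)]
  | more k ih _ =>
    have e1 : ((k + 2 + 1 : ℕ) : ℝ) / 2 = (k + 1 : ℕ) / 2 + 1 := by push_cast; ring
    have e2 : (((k + 2 + 1 : ℕ) : ℝ) + 1) / 2 = ((k + 1 : ℕ) + 1) / 2 + 1 := by push_cast; ring
    rw [e1, e2, Real.Gamma_add_one (by positivity), Real.Gamma_add_one (by positivity)]
    have hs : √((k + 2 + 1 : ℕ) : ℝ) * ((k + 1 : ℕ) / 2) ≤
        √((k + 1 : ℕ) : ℝ) * (((k + 1 : ℕ) + 1) / 2) := by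
      refine (sq_le_sq₀ (by positivity) (by positivity)).1 ?_
      rw [mul_pow, mul_pow, Real.sq_sqrt (by positivity), Real.sq_sqrt (by positivity)]
      push_cast
      have : (0 : ℝ) ≤ k := k.cast_nonneg
      nlinarith
    have hG := (Real.Gamma_pos_of_pos (s := ((k + 1 : ℕ) : ℝ) / 2) (by positivity)).le
    calc _ = √((k + 2 + 1 : ℕ) : ℝ) * ((k + 1 : ℕ) / 2) * Real.Gamma ((k + 1 : ℕ) / 2) := by ring
      _ ≤ √((k + 1 : ℕ) : ℝ) * (((k + 1 : ℕ) + 1) / 2) * Real.Gamma ((k + 1 : ℕ) / 2) := by gcongr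
      _ = ((k + 1 : ℕ) + 1) / 2 * (√((k + 1 : ℕ) : ℝ) * Real.Gamma ((k + 1 : ℕ) / 2)) := by ring
      _ ≤ ((k + 1 : ℕ) + 1) / 2 * (√Real.pi * Real.Gamma (((k + 1 : ℕ) + 1) / 2)) := by gcongr
      _ = _ := by ring

theorem volume_ball_zero_one (n : ℕ) :
    volume (ball (0 : Eu n) 1) = ENNReal.ofReal (√Real.pi ^ n / Real.Gamma (n / 2 + 1)) := by
  rcases n with _ | n
  · simp [volume_euclideanSpace_eq_dirac]
  · simp [EuclideanSpace.volume_ball]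

theorem ofReal_two_mul_sqrt_le {n : ℕ} (hn : 1 ≤ n) :
    ENNReal.ofReal (2 * √n) ≤
      (n : ℝ≥0∞) * volume (ball (0 : Eu n) 1) / volume (ball (0 : Eu (n - 1)) 1) := by
  obtain ⟨k, rfl⟩ := Nat.exists_eq_add_of_le' hn
  have h1 : 0 < Real.Gamma ((k : ℝ) / 2 + 1) := Real.Gamma_pos_of_pos (by positivity)
  have h2 : 0 < Real.Gamma (((k + 1 : ℕ) : ℝ) / 2) := Real.Gamma_pos_of_pos (by positivity)
  rw [volume_ball_zero_one, volume_ball_zero_one, Nat.add_sub_cancel, ← ENNReal.ofReal_natCast,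
    ← ENNReal.ofReal_mul (by positivity), ← ENNReal.ofReal_div_of_pos (by positivity)]
  refine ENNReal.ofReal_le_ofReal ?_
  have hk := sqrt_mul_Gamma_le k
  rw [show (((k + 1 : ℕ) : ℝ) + 1) / 2 = k / 2 + 1 by push_cast; ring] at hk
  rw [Real.Gamma_add_one (s := ((k + 1 : ℕ) : ℝ) / 2) (by positivity), pow_succ,
    show ((k + 1 : ℕ) : ℝ) * (√Real.pi ^ k * √Real.pi /
      (((k + 1 : ℕ) : ℝ) / 2 * Real.Gamma (((k + 1 : ℕ) : ℝ) / 2))) /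
      (√Real.pi ^ k / Real.Gamma ((k : ℝ) / 2 + 1)) =
      2 * (√Real.pi * Real.Gamma ((k : ℝ) / 2 + 1)) / Real.Gamma (((k + 1 : ℕ) : ℝ) / 2) by
        field_simp, le_div_iff₀ h2]
  linarith

/-- The constant function one has vanishing gradient measure. -/
theorem hasGradMeasure_one_zero {n : ℕ} (Ω : Set (Eu n)) :
    HasGradMeasure Ω (fun _ => (1 : ℝ)) 0 0 := by
  refine ⟨by simp, by simp, fun φ hφ => ?_⟩
  have hub : BddFun Ω (fun _ => (1 : ℝ)) 1 := ⟨aestronglyMeasurable_const, by simp⟩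
  ext j
  rw [setIntegral_smul_gradient_apply hub hφ.1 hφ.2.1]
  simp only [one_mul, integral_zero_measure, neg_zero, PiLp.zero_apply]
  rw [setIntegral_eq_integral_of_forall_compl_eq_zero fun x hx => by
    rw [fderiv_of_notMem_tsupport ℝ fun h => hx (hφ.2.2 h), zero_apply]]
  have hderiv_int : Integrable fun x => fderiv ℝ φ x (EuclideanSpace.single j (1 : ℝ)) :=
    ((hφ.1.continuous_fderiv (by simp)).clm_apply continuous_const).integrable_of_hasCompactSupport
      (hφ.2.1.fderiv_apply (𝕜 := ℝ) _)
  have h := integral_mul_fderiv_eq_neg_fderiv_mul_of_integrable (μ := volume)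
    (f := fun _ : Eu n => (1 : ℝ)) (g := φ) (v := EuclideanSpace.single j (1 : ℝ)) (by simp)
    (by simpa using hderiv_int)
    (by simpa using hφ.1.continuous.integrable_of_hasCompactSupport hφ.2.1) (by simp)
    fun x _ => (hφ.1.differentiable (by simp)) x
  simpa using h

/-- BV extension by zero: if `H^{n-1}(∂Ω) < ∞`, then for every
`u ∈ BV(Ω) ∩ L^∞(Ω)` with `|u| ≤ C` a.e., the extension `𝟙_Ω u` belongs to `BV(ℝⁿ)` with
`|D(𝟙_Ω u)|(∂Ω) ≤ (n ω_n / ω_{n-1}) C H^{n-1}(∂Ω)`; in particular `Ω` has finite perimeter. -/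
theorem stmt2 {n : ℕ} (hn1 : 1 ≤ n) (Ω : Set (Eu n)) (hΩ : IsOpen Ω)
    (hfr : hm n (frontier Ω) < ⊤) (u : Eu n → ℝ) (C : ℝ) (hC : 0 ≤ C)
    (hu1 : IntegrableOn u Ω) (hub : BddFun Ω u C)
    (ν : Measure (Eu n)) (θ : Eu n → Eu n) (hν : FinOn Ω ν)
    (hgrad : HasGradMeasure Ω u ν θ) :
    (IntegrableOn (Ω.indicator u) (univ : Set (Eu n)) ∧
      ∃ ν' θ', (ν' univ < ⊤) ∧ HasGradMeasure (univ : Set (Eu n)) (Ω.indicator u) ν' θ' ∧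
        ν' (frontier Ω) ≤ (n : ℝ≥0∞) * volume (ball (0 : Eu n) 1)
          / volume (ball (0 : Eu (n - 1)) 1) * ENNReal.ofReal C * hm n (frontier Ω)) ∧
    ∃ νc θc, (νc univ < ⊤) ∧
      HasGradMeasure (univ : Set (Eu n)) (Ω.indicator fun _ => (1 : ℝ)) νc θc := by
  have : IsFiniteMeasure ν := ⟨hν.1⟩
  refine ⟨⟨?_, ?_⟩, ?_⟩
  · rw [integrableOn_univ, integrable_indicator_iff hΩ.measurableSet]
    exact hu1
  · obtain ⟨ν', θ', hfin, hg, hle⟩ := exists_hasGradMeasure_indicator hn1 hΩ hfr hC hub hgrad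
    refine ⟨ν', θ', hfin, hg, hle.trans ?_⟩
    gcongr
    exact ofReal_two_mul_sqrt_le hn1
  · obtain ⟨νc, θc, hfin, hg, -⟩ := exists_hasGradMeasure_indicator hn1 hΩ hfr zero_le_one
      ⟨aestronglyMeasurable_const, by simp⟩ (hasGradMeasure_one_zero Ω)
    exact ⟨νc, θc, hfin, hg⟩
end
end
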